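/- Let n ≥ 2. The set of chaotic automorphisms has empty interior in Aut_{ω₀}(ℂⁿ): every nonempty open subset of Aut_{ω₀}(ℂⁿ) contains an automorphism that is not chaotic. -/

import Mathlib

open Topology Filter Metric Set Function

noncomputable section

/-- ℂⁿ with the Euclidean norm. -/
abbrev En (n : ℕ) : Type := EuclideanSpace ℂ (Fin n)

/-- A holomorphic automorphism of ℂⁿ: a bijection that is holomorphic with holomorphic inverse. -/
def IsHoloAut {n : ℕ} (f : En n → En n) : Prop :=
  Differentiable ℂ f ∧ ∃ g : En n → En n, Differentiable ℂ g ∧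
    Function.LeftInverse g f ∧ Function.RightInverse g f

/-- Volume-preserving with respect to ω₀ = dz₁∧⋯∧dzₙ: det Df(z) = 1 for all z. -/
def IsVolPres {n : ℕ} (f : En n → En n) : Prop :=
  ∀ z : En n, (fderiv ℂ f z).det = 1

/-- Aut(ℂⁿ) as a subset of C(ℂⁿ, ℂⁿ) with the compact-open topology. -/
def AutCN (n : ℕ) : Set C(En n, En n) := {f | IsHoloAut ⇑f}

/-- Aut_{ω₀}(ℂⁿ) as a subset of C(ℂⁿ, ℂⁿ) with the compact-open topology. -/
def AutOmega (n : ℕ) : Set C(En n, En n) := {f | IsHoloAut ⇑f ∧ IsVolPres ⇑f}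

/-- A continuous self-map is chaotic if it has a dense forward orbit and its set of
periodic points is dense. -/
def Chaotic {α : Type*} [TopologicalSpace α] (f : α → α) : Prop :=
  (∃ x : α, Dense (Set.range fun k : ℕ => f^[k] x)) ∧
  Dense {x : α | ∃ k : ℕ, 0 < k ∧ f^[k] x = x}

/-- Expelling: the set of points with unbounded forward orbit is dense. -/
def Expelling {n : ℕ} (f : En n → En n) : Prop :=
  Dense {x : En n | ¬ Bornology.IsBounded (Set.range fun k : ℕ => f^[k] x)}

/-- p is a hyperbolic fixed point of f: f(p) = p and no eigenvalue of Df(p) has modulus 1. -/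
def HypFixedPt {n : ℕ} (f : En n → En n) (p : En n) : Prop :=
  f p = p ∧ ∀ μ : ℂ, Module.End.HasEigenvalue
    ((fderiv ℂ f p : En n →ₗ[ℂ] En n) : Module.End ℂ (En n)) μ → ‖μ‖ ≠ 1

/-- The stable manifold of a fixed point p of f: points whose forward orbit tends to p. -/
def StableSet {n : ℕ} (f : En n → En n) (p : En n) : Set (En n) :=
  {x : En n | Tendsto (fun k : ℕ => f^[k] x) atTop (𝓝 p)}

/-- For n ≥ 2, the set of chaotic automorphisms has empty interior in
Aut_{ω₀}(ℂⁿ): every nonempty open subset of Aut_{ω₀}(ℂⁿ) contains a non-chaotic automorphism. -/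

lemma cauchy_fderiv {F : Type*} [NormedAddCommGroup F] [NormedSpace ℂ F] {n : ℕ} {u : En n → F}
    (hu : Differentiable ℂ u) {z : En n} {M r : ℝ} (hr : 0 < r)
    (hM : ∀ w ∈ closedBall z r, ‖u w‖ ≤ M) : ‖fderiv ℂ u z‖ ≤ 2 * M / r := by
  apply Complex.norm_fderiv_le_div_of_mapsTo_ball hu.differentiableOn _ hr
  intro w hw
  rw [mem_closedBall, dist_eq_norm]
  have h1 := hM w (ball_subset_closedBall hw)
  have h2 := hM z (mem_closedBall_self hr.le)
  calc _ ≤ ‖u w‖ + ‖u z‖ := norm_sub_le _ _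
    _ ≤ _ := by linarith

lemma exists_bound {F : Type*} [NormedAddCommGroup F] {n : ℕ} {u : En n → F}
    (hu : Continuous u) (R : ℝ) : ∃ M, 0 < M ∧ ∀ w, ‖w‖ ≤ R → ‖u w‖ ≤ M := by
  obtain ⟨M, hM⟩ := (isCompact_closedBall (0 : En n) R).exists_bound_of_continuousOn hu.continuousOn
  exact ⟨max M 1, by positivity, fun w hw => (hM w (by simpa using hw)).trans (le_max_left _ _)⟩

lemma fderiv_dir_integral {F : Type*} [NormedAddCommGroup F] [NormedSpace ℂ F] [CompleteSpace F]
    {n : ℕ} {u : En n → F} (hu : Differentiable ℂ u) (z v : En n) :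
    fderiv ℂ u z v = (2 * Real.pi * Complex.I : ℂ)⁻¹ •
      ∮ ζ in C((0:ℂ), 1), ((ζ - 0) ^ 2)⁻¹ • u (z + ζ • v) := by
  have h1 : HasDerivAt (fun ζ : ℂ => u (z + ζ • v)) (fderiv ℂ u z v) 0 := by
    have h2 : HasDerivAt (fun ζ : ℂ => z + ζ • v) v 0 := by
      simpa using ((hasDerivAt_id (0:ℂ)).smul_const v).const_add z
    have h3 : HasFDerivAt u (fderiv ℂ u z) (z + (0:ℂ) • v) := by
      simpa using (hu z).hasFDerivAt
    exact h3.comp_hasDerivAt (0:ℂ) h2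
  rw [← h1.deriv]
  have hd : Differentiable ℂ (fun ζ : ℂ => u (z + ζ • v)) := by fun_prop
  have := hd.diffContOnCl (s := ball (0:ℂ) 1)
  have h := this.deriv_eq_smul_circleIntegral (by norm_num)
  simp only [one_div] at h
  rw [h, inv_smul_smul₀ Complex.two_pi_I_ne_zero]

lemma diff_dirderiv {F : Type*} [NormedAddCommGroup F] [NormedSpace ℂ F] [FiniteDimensional ℂ F]
    {n : ℕ} {u : En n → F} (hu : Differentiable ℂ u) (v : En n) :
    Differentiable ℂ (fun z => fderiv ℂ u z v) := by
  have : CompleteSpace F := FiniteDimensional.complete ℂ F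
  intro z₀
  simp_rw [fderiv_dir_integral hu]
  refine DifferentiableAt.const_smul ?_ _
  unfold circleIntegral
  obtain ⟨M, hM0, hM⟩ := exists_bound hu.continuous (‖z₀‖ + 1 + ‖v‖ + 1)
  have hcc : Continuous (fun θ : ℝ => deriv (circleMap 0 1) θ) := by
    simp only [deriv_circleMap]; fun_prop
  have hne : ∀ θ : ℝ, circleMap 0 1 θ ≠ 0 := fun θ => by simp
  have hcw : Continuous (fun θ : ℝ => ((circleMap 0 1 θ - 0) ^ 2)⁻¹) := by
    apply Continuous.inv₀ (by fun_prop)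
    intro θ; simp
  have hmv : ∀ z, ∀ θ : ℝ, HasFDerivAt (fun z => deriv (circleMap 0 1) θ •
      ((circleMap 0 1 θ - 0) ^ 2)⁻¹ • u (z + circleMap 0 1 θ • v))
      (deriv (circleMap 0 1) θ • ((circleMap 0 1 θ - 0) ^ 2)⁻¹ •
        fderiv ℂ u (z + circleMap 0 1 θ • v)) z := by
    intro z θ
    refine HasFDerivAt.const_smul (HasFDerivAt.const_smul ?_ _) _
    have := (hu (z + circleMap 0 1 θ • v)).hasFDerivAt
    simpa [comp_def] using this.comp z ((hasFDerivAt_id z).add_const (circleMap 0 1 θ • v))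
  have hcu : Continuous u := hu.continuous
  refine (intervalIntegral.hasFDerivAt_integral_of_dominated_of_fderiv_le
    (s := ball z₀ 1) (bound := fun _ => 2 * M / 1)
    (F' := fun z θ => (deriv (circleMap 0 1) θ • ((circleMap 0 1 θ - 0) ^ 2)⁻¹ •
        fderiv ℂ u (z + circleMap 0 1 θ • v)))
    (ball_mem_nhds _ one_pos) ?_ ?_ ?_ ?_ ?_ ?_).differentiableAt
  · refine Eventually.of_forall fun z => ?_
    apply Continuous.aestronglyMeasurable
    fun_prop
  · apply Continuous.intervalIntegrable
    fun_prop
  · have : FiniteDimensional ℂ (En n →L[ℂ] F) := inferInstance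
    have : ProperSpace (En n →L[ℂ] F) := FiniteDimensional.proper ℂ _
    borelize (En n →L[ℂ] F)
    have h1 : Measurable (fun θ : ℝ => fderiv ℂ u (z₀ + circleMap 0 1 θ • v)) :=
      (measurable_fderiv ℂ u).comp (Continuous.measurable (by fun_prop))
    exact hcc.aestronglyMeasurable.smul (hcw.aestronglyMeasurable.smul h1.aestronglyMeasurable)
  · refine Eventually.of_forall fun θ _ z hz => ?_
    rw [norm_smul, norm_smul]
    simp only [deriv_circleMap, norm_mul, Complex.norm_I, norm_circleMap_zero, norm_inv, norm_pow, sub_zero]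
    simp only [abs_one, one_pow, inv_one, one_mul, mul_one]
    apply cauchy_fderiv hu one_pos
    intro w hw
    apply hM
    rw [mem_closedBall, dist_eq_norm] at hw
    rw [mem_ball, dist_eq_norm] at hz
    have e : w = (w - (z + circleMap 0 1 θ • v)) + (z - z₀) + z₀ + circleMap 0 1 θ • v := by abel
    rw [e]
    have h3 : ‖circleMap 0 1 θ • v‖ = ‖v‖ := by rw [norm_smul]; simp
    refine (norm_add_le _ _).trans ?_
    rw [h3]
    have := norm_add₃_le (a := w - (z + circleMap 0 1 θ • v)) (b := z - z₀) (c := z₀)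
    linarith
  · exact intervalIntegrable_const
  · exact Eventually.of_forall fun θ _ z hz => hmv z θ

lemma diff_fderiv {F : Type*} [NormedAddCommGroup F] [NormedSpace ℂ F] [FiniteDimensional ℂ F]
    {n : ℕ} {u : En n → F} (hu : Differentiable ℂ u) : Differentiable ℂ (fderiv ℂ u) := by
  have h : ∀ z, fderiv ℂ u z = ∑ i : Fin n, (EuclideanSpace.proj i : En n →L[ℂ] ℂ).smulRight
      (fderiv ℂ u z (EuclideanSpace.single i 1)) := by
    intro z
    ext w
    have hw : w = ∑ i : Fin n, w i • EuclideanSpace.single i (1:ℂ) := by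
      ext j; simp [Finset.sum_apply, Pi.single_apply]
    conv_lhs => rw [hw]
    simp
  have h2 : fderiv ℂ u = fun z => ∑ i : Fin n, (EuclideanSpace.proj i : En n →L[ℂ] ℂ).smulRight
      (fderiv ℂ u z (EuclideanSpace.single i 1)) := funext h
  rw [h2]
  refine Differentiable.fun_sum fun i _ => ?_
  exact ((ContinuousLinearMap.smulRightL ℂ (En n) F (EuclideanSpace.proj i)).differentiable).comp
    (diff_dirderiv hu _)


abbrev eb {n : ℕ} (i : Fin n) : En n := EuclideanSpace.single i (1:ℂ)

def ev {n : ℕ} (P : MvPolynomial (Fin n) ℂ) (z : En n) : ℂ := MvPolynomial.eval (fun i => z i) P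

lemma ev_hasFDerivAt {n : ℕ} (P : MvPolynomial (Fin n) ℂ) (z : En n) :
    HasFDerivAt (ev P) (∑ i, ev (MvPolynomial.pderiv i P) z • (EuclideanSpace.proj i : En n →L[ℂ] ℂ)) z := by
  induction P using MvPolynomial.induction_on with
  | C a => 
    have : ev (MvPolynomial.C a) = fun _ : En n => a := by ext w; simp [ev]
    rw [this]
    refine (hasFDerivAt_const (𝕜 := ℂ) a z).congr_fderiv ?_
    ext w; simp [ev]
  | add p q hp hq =>
    have : ev (p + q) = fun w : En n => ev p w + ev q w := by ext w; simp [ev]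
    rw [this]
    refine (hp.add hq).congr_fderiv ?_
    rw [← Finset.sum_add_distrib]
    refine Finset.sum_congr rfl fun i _ => ?_
    rw [← add_smul]; simp [ev]
  | mul_X p j hp =>
    have : ev (p * MvPolynomial.X j) = fun w : En n => ev p w * w j := by ext w; simp [ev]
    rw [this]
    refine (hp.mul (EuclideanSpace.proj j : En n →L[ℂ] ℂ).hasFDerivAt).congr_fderiv ?_
    have : ∀ i, ev (MvPolynomial.pderiv i (p * MvPolynomial.X j)) z
      = ev p z * (if j = i then 1 else 0) + ev (MvPolynomial.pderiv i p) z * z j := by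
      intro i
      simp only [ev, Derivation.leibniz, MvPolynomial.pderiv_X, Pi.single_apply, smul_eq_mul, map_add, map_mul,
        MvPolynomial.eval_X]
      simp only [@eq_comm _ j i]
      by_cases h : i = j <;> simp [h] <;> ring
    ext w
    simp only [this, add_apply, sum_apply, smul_apply, smul_eq_mul, PiLp.proj_apply, add_mul,
      Finset.sum_add_distrib]
    congr 1
    · simp
    · rw [Finset.mul_sum]
      refine Finset.sum_congr rfl fun i _ => ?_
      ring

lemma ev_diff {n : ℕ} (P : MvPolynomial (Fin n) ℂ) : Differentiable ℂ (ev P) :=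
  fun z => (ev_hasFDerivAt P z).differentiableAt

lemma ev_pd {n : ℕ} (P : MvPolynomial (Fin n) ℂ) (z : En n) (i : Fin n) :
    fderiv ℂ (ev P) z (eb i) = ev (MvPolynomial.pderiv i P) z := by
  rw [(ev_hasFDerivAt P z).fderiv]
  simp

def PolyApprox {n : ℕ} (u : En n → ℂ) : Prop :=
  ∀ R ε : ℝ, 0 < ε → ∃ P : MvPolynomial (Fin n) ℂ, ∀ z, ‖z‖ ≤ R → ‖u z - ev P z‖ ≤ ε

/-- directional derivative -/
def DD {n : ℕ} (i : Fin n) (u : En n → ℂ) : En n → ℂ := fun z => fderiv ℂ u z (eb i)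

lemma DD_diff {n : ℕ} (i : Fin n) {u : En n → ℂ} (hu : Differentiable ℂ u) :
    Differentiable ℂ (DD i u) := diff_dirderiv hu _

lemma DDk_diff {n : ℕ} (i : Fin n) {u : En n → ℂ} (hu : Differentiable ℂ u) (k : ℕ) :
    Differentiable ℂ ((DD i)^[k] u) := by
  induction k with
  | zero => simpa
  | succ k ih => rw [iterate_succ_apply']; exact DD_diff i ih

lemma iteratedDeriv_line {n : ℕ} (i : Fin n) {u : En n → ℂ} (hu : Differentiable ℂ u) (k : ℕ) (w : En n) :
    iteratedDeriv k (fun ζ : ℂ => u (w + ζ • eb i)) = fun ζ => ((DD i)^[k] u) (w + ζ • eb i) := by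
  induction k with
  | zero => simp
  | succ k ih =>
    rw [iteratedDeriv_succ, ih]
    ext ζ
    rw [iterate_succ_apply']
    have h2 : HasDerivAt (fun ζ : ℂ => w + ζ • eb i) (eb i) ζ := by
      simpa using ((hasDerivAt_id (ζ:ℂ)).smul_const (eb i)).const_add w
    have h3 := (DDk_diff i hu k (w + ζ • eb i)).hasFDerivAt
    exact (h3.comp_hasDerivAt ζ h2).deriv

lemma norm_coord_le {n : ℕ} (z : En n) (i : Fin n) : ‖z i‖ ≤ ‖z‖ := PiLp.norm_apply_le z i

lemma norm_eb {n : ℕ} (i : Fin n) : ‖eb i‖ = 1 := by simp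

lemma taylor_dir {n : ℕ} (i : Fin n) {u : En n → ℂ} (hu : Differentiable ℂ u) {R ε : ℝ} (hR : 0 < R)
    (hε : 0 < ε) : ∃ m : ℕ, ∀ z, ‖z‖ ≤ R →
      ‖u z - ∑ k ∈ Finset.range m, (k.factorial : ℂ)⁻¹ * (z i) ^ k *
        ((DD i)^[k] u) (z - z i • eb i)‖ ≤ ε := by
  obtain ⟨M, hM0, hM⟩ := exists_bound hu.continuous (4 * R)
  have ht : Tendsto (fun m : ℕ => M * (1/2:ℝ) ^ m / (1 - 1/2)) atTop (𝓝 (M * 0 / (1 - 1/2))) :=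
    ((tendsto_pow_atTop_nhds_zero_of_lt_one (by norm_num) (by norm_num)).const_mul M).div_const _
  rw [mul_zero, zero_div] at ht
  obtain ⟨m, hm⟩ := (ht.eventually (gt_mem_nhds hε)).exists
  refine ⟨m, fun z hz => ?_⟩
  set w := z - z i • eb i with hw
  have hzi := norm_coord_le z i
  have hwn : ‖w‖ ≤ 2 * R := by
    calc ‖w‖ ≤ ‖z‖ + ‖z i • eb i‖ := norm_sub_le _ _
      _ ≤ 2 * R := by rw [norm_smul, norm_eb]; linarith
  have hd : Differentiable ℂ (fun ζ : ℂ => u (w + ζ • eb i)) := by fun_prop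
  have hs := Complex.hasSum_taylorSeries_of_entire hd 0 (z i)
  simp only [iteratedDeriv_line i hu, sub_zero, smul_eq_mul, zero_smul, add_zero] at hs
  have e : w + z i • eb i = z := by simp [hw]
  rw [e] at hs
  have hb : ∀ k : ℕ, ‖(k.factorial : ℂ)⁻¹ * ((z i) ^ k * ((DD i)^[k] u) w)‖ ≤ M * (1/2:ℝ) ^ k := by
    intro k
    have h1 : ‖iteratedDeriv k (fun ζ : ℂ => u (w + ζ • eb i)) 0‖ ≤ k.factorial * M / (2 * R) ^ k := by
      apply Complex.norm_iteratedDeriv_le_of_forall_mem_sphere_norm_le k (by positivity) hd.diffContOnCl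
      intro ζ hζ
      apply hM
      refine (norm_add_le _ _).trans ?_
      rw [norm_smul, norm_eb]
      have : ‖ζ‖ = 2 * R := by simpa using hζ
      linarith
    rw [iteratedDeriv_line i hu] at h1
    simp only [zero_smul, add_zero] at h1
    rw [norm_mul, norm_mul, norm_inv, norm_pow, Complex.norm_natCast]
    have hk : (0:ℝ) < k.factorial := by positivity
    calc _ ≤ (k.factorial : ℝ)⁻¹ * (R ^ k * (k.factorial * M / (2 * R) ^ k)) := by
          gcongr; exact hzi.trans hz
      _ = _ := by
          rw [mul_pow, one_div, inv_pow]; field_simp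
  have := norm_sub_le_of_geometric_bound_of_hasSum (by norm_num) hb hs m
  rw [norm_sub_rev] at this
  simp only [mul_assoc]
  exact this.trans hm.le

def DepOn {n : ℕ} (s : Finset (Fin n)) (u : En n → ℂ) : Prop :=
  ∀ z w, (∀ i ∈ s, z i = w i) → u z = u w

lemma DepOn.DD {n : ℕ} {s : Finset (Fin n)} {u : En n → ℂ} (h : DepOn s u) (i : Fin n) :
    DepOn s (DD i u) := by
  intro z w hzw
  unfold _root_.DD
  have h1 : (fun x => u (x + z)) = fun x => u (x + w) := by
    ext x; apply h; intro i hi; simp [hzw i hi]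
  have h2 := fderiv_comp_add_right (𝕜 := ℂ) (f := u) (x := 0) z
  have h3 := fderiv_comp_add_right (𝕜 := ℂ) (f := u) (x := 0) w
  rw [zero_add] at h2 h3
  rw [← h2, ← h3, h1]

lemma DepOn.DDk {n : ℕ} {s : Finset (Fin n)} {u : En n → ℂ} (h : DepOn s u) (i : Fin n) (k : ℕ) :
    DepOn s ((_root_.DD i)^[k] u) := by
  induction k with
  | zero => simpa
  | succ k ih => rw [iterate_succ_apply']; exact ih.DD i

lemma polyApprox_dep {n : ℕ} (s : Finset (Fin n)) : ∀ u : En n → ℂ, Differentiable ℂ u → DepOn s u →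
    PolyApprox u := by
  induction s using Finset.induction_on with
  | empty =>
    intro u _ hs R ε hε
    refine ⟨MvPolynomial.C (u 0), fun z _ => ?_⟩
    rw [hs z 0 (by simp)]
    simp [ev, hε.le]
  | insert i s his ih =>
    intro u hu hs R ε hε
    set R' := max R 1
    have hR' : 0 < R' := by positivity
    obtain ⟨m, hm⟩ := taylor_dir i hu hR' (half_pos hε)
    have hk : ∀ k, PolyApprox (fun z => ((DD i)^[k] u) (z - z i • eb i)) := by
      intro k
      apply ih
      · have hc : Differentiable ℂ (fun z : En n => z i) :=
          (EuclideanSpace.proj i : En n →L[ℂ] ℂ).differentiable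
        have hL : Differentiable ℂ (fun z : En n => z - z i • eb i) :=
          differentiable_id.sub (hc.smul_const _)
        exact (DDk_diff i hu k).comp hL
      · intro z w hzw
        apply hs.DDk i k
        intro j hj
        rw [Finset.mem_insert] at hj
        by_cases hji : j = i
        · subst hji; simp
        · have := hzw j (hj.resolve_left hji)
          simp [hji, this]
    set δ : ℝ := ε / 2 / ((m + 1) * R' ^ m) with hδ
    have hδ0 : 0 < δ := by positivity
    have := fun k => hk k R' δ hδ0
    choose P hP using this
    refine ⟨∑ k ∈ Finset.range m, MvPolynomial.C ((k.factorial : ℂ)⁻¹) * MvPolynomial.X i ^ k * P k,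
      fun z hz => ?_⟩
    have hz' : ‖z‖ ≤ R' := hz.trans (le_max_left _ _)
    have e : ev (∑ k ∈ Finset.range m, MvPolynomial.C ((k.factorial : ℂ)⁻¹) * MvPolynomial.X i ^ k * P k) z
      = ∑ k ∈ Finset.range m, (k.factorial : ℂ)⁻¹ * (z i) ^ k * ev (P k) z := by
      simp [ev]
    rw [e]
    set A := ∑ k ∈ Finset.range m, (k.factorial : ℂ)⁻¹ * (z i) ^ k *
        ((DD i)^[k] u) (z - z i • eb i) with hA
    have h1 := hm z hz'
    have h2 : ‖A - ∑ k ∈ Finset.range m, (k.factorial : ℂ)⁻¹ * (z i) ^ k * ev (P k) z‖ ≤ ε / 2 := by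
      rw [hA, ← Finset.sum_sub_distrib]
      refine (norm_sum_le_of_le (f := fun k => _) _ (n := fun k => R' ^ m * δ) ?_).trans ?_
      · intro k hk
        rw [← mul_sub, norm_mul, norm_mul, norm_inv, norm_pow, Complex.norm_natCast]
        have hf : ((k.factorial : ℝ))⁻¹ ≤ 1 := inv_le_one_of_one_le₀ (by exact_mod_cast k.factorial_pos)
        have hp : ‖z i‖ ^ k ≤ R' ^ m := by
          calc ‖z i‖ ^ k ≤ R' ^ k := by gcongr; exact (norm_coord_le z i).trans hz'
            _ ≤ _ := pow_le_pow_right₀ (le_max_right _ _) (Finset.mem_range.1 hk).le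
        calc _ ≤ 1 * R' ^ m * δ := by gcongr; exact hP k z hz'
          _ = _ := by ring
      · rw [Finset.sum_const, Finset.card_range, nsmul_eq_mul, hδ]
        have : (0:ℝ) < R' ^ m := by positivity
        have e2 : (m:ℝ) * (R' ^ m * (ε / 2 / ((m + 1) * R' ^ m))) = (ε / 2) * (m / (m + 1)) := by
          field_simp
        rw [e2]
        apply mul_le_of_le_one_right (by positivity)
        rw [div_le_one (by positivity)]; linarith
    calc _ = ‖(u z - A) + (A - ∑ k ∈ Finset.range m, (k.factorial : ℂ)⁻¹ * (z i) ^ k * ev (P k) z)‖ := by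
          congr 1; ring
      _ ≤ _ := (norm_add_le _ _).trans (by linarith)

lemma polyApprox {n : ℕ} {u : En n → ℂ} (hu : Differentiable ℂ u) : PolyApprox u :=
  polyApprox_dep Finset.univ u hu (fun z w h => by
    have : z = w := by ext i; exact h i (Finset.mem_univ i)
    rw [this])


def PolyMap {n : ℕ} (S : En n → En n) : Prop :=
  ∃ P : Fin n → MvPolynomial (Fin n) ℂ, ∀ z i, S z i = ev (P i) z

def PS {n : ℕ} (S : En n → En n) : Prop := IsHoloAut S ∧ IsVolPres S ∧ PolyMap S

lemma IsHoloAut.comp {n : ℕ} {S T : En n → En n} (hS : IsHoloAut S) (hT : IsHoloAut T) :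
    IsHoloAut (fun z => S (T z)) := by
  obtain ⟨hS1, g, hg, hg1, hg2⟩ := hS
  obtain ⟨hT1, k, hk, hk1, hk2⟩ := hT
  exact ⟨hS1.comp hT1, fun z => k (g z), hk.comp hg, fun z => by simp [hg1 _, hk1 _],
    fun z => by simp [hg2 _, hk2 _]⟩

lemma IsVolPres.comp {n : ℕ} {S T : En n → En n} (hS : IsVolPres S) (hT : IsVolPres T)
    (dS : Differentiable ℂ S) (dT : Differentiable ℂ T) : IsVolPres (fun z => S (T z)) := by
  intro z
  have h := fderiv_comp z (dS (T z)) (dT z)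
  have h' : fderiv ℂ (fun z => S (T z)) z = (fderiv ℂ S (T z)).comp (fderiv ℂ T z) := h
  rw [h']
  have h1 := hS (T z)
  have h2 := hT z
  rw [ContinuousLinearMap.det] at *
  rw [ContinuousLinearMap.toLinearMap_comp, LinearMap.det_comp, h1, h2, one_mul]

lemma PolyMap.comp {n : ℕ} {S T : En n → En n} (hS : PolyMap S) (hT : PolyMap T) :
    PolyMap (fun z => S (T z)) := by
  obtain ⟨P, hP⟩ := hS
  obtain ⟨Q, hQ⟩ := hT
  refine ⟨fun i => MvPolynomial.bind₁ Q (P i), fun z i => ?_⟩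
  rw [hP]
  unfold ev
  have : (fun i => T z i) = fun i => MvPolynomial.eval (fun i => z i) (Q i) := funext fun i => hQ z i
  rw [this, ← MvPolynomial.aeval_eq_eval, ← MvPolynomial.aeval_eq_eval, MvPolynomial.aeval_bind₁]

lemma PS.comp {n : ℕ} {S T : En n → En n} (hS : PS S) (hT : PS T) : PS (fun z => S (T z)) :=
  ⟨hS.1.comp hT.1, hS.2.1.comp hT.2.1 hS.1.1 hT.1.1, hS.2.2.comp hT.2.2⟩

lemma clm_eq_sum {n : ℕ} {F : Type*} [NormedAddCommGroup F] [NormedSpace ℂ F] (A : En n →L[ℂ] F) (z : En n) :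
    A z = ∑ j, z j • A (eb j) := by
  have hw : z = ∑ i : Fin n, z i • EuclideanSpace.single i (1:ℂ) := by
    ext j; simp [Finset.sum_apply, Pi.single_apply]
  conv_lhs => rw [hw]
  simp

lemma ps_affine {n : ℕ} (a : En n) (A : En n →L[ℂ] En n) (hA : A.det = 1) : PS (fun z => a + A z) := by
  refine ⟨⟨by fun_prop, ?_⟩, ?_, ?_⟩
  · have hdet : LinearMap.det (A : En n →ₗ[ℂ] En n) ≠ 0 := by
      have : LinearMap.det (A : En n →ₗ[ℂ] En n) = 1 := hA
      rw [this]; exact one_ne_zero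
    set B := (LinearMap.equivOfDetNeZero (A : En n →ₗ[ℂ] En n) hdet).toContinuousLinearEquiv with hB
    have hBA : ∀ z, B z = A z := fun z => rfl
    refine ⟨fun w => B.symm (w - a), ?_, fun z => ?_, fun w => ?_⟩
    · exact B.symm.differentiable.comp (differentiable_id.sub_const a)
    · simp [← hBA]
    · simp [← hBA]
  · intro z
    have : fderiv ℂ (fun z => a + A z) z = A := by
      rw [fderiv_const_add]; exact A.fderiv
    rw [this, hA]
  · refine ⟨fun i => MvPolynomial.C (a i) + ∑ j, MvPolynomial.C (A (eb j) i) * MvPolynomial.X j, fun z i => ?_⟩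
    beta_reduce
    rw [clm_eq_sum A z]
    simp [ev, mul_comm]

lemma ps_shear {n : ℕ} (ℓ : En n →L[ℂ] ℂ) (v : En n) (hv : ℓ v = 0) (c : ℂ) (k : ℕ) :
    PS (fun z => z + (c * (ℓ z) ^ k) • v) := by
  refine ⟨⟨by fun_prop, fun z => z - (c * (ℓ z) ^ k) • v, by fun_prop, fun z => ?_, fun z => ?_⟩, ?_, ?_⟩
  · simp [hv]
  · simp [hv]
  · intro z
    have h1 : HasFDerivAt (fun z => c * (ℓ z) ^ k) ((c * (k * (ℓ z) ^ (k - 1))) • ℓ) z := by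
      have := ((ℓ.hasFDerivAt (x := z)).pow k).const_mul c
      refine this.congr_fderiv ?_
      ext w; simp; ring
    have h2 : HasFDerivAt (fun z => z + (c * (ℓ z) ^ k) • v)
      (ContinuousLinearMap.id ℂ _ + ((c * (k * (ℓ z) ^ (k - 1))) • ℓ).smulRight v) z :=
      (hasFDerivAt_id z).add (h1.smul_const v)
    rw [h2.fderiv, ContinuousLinearMap.det]
    have h3 : ((ContinuousLinearMap.id ℂ (En n) + ((c * (k * (ℓ z) ^ (k - 1))) • ℓ).smulRight v :
      En n →L[ℂ] En n) : En n →ₗ[ℂ] En n) =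
      LinearMap.transvection ((((c * (k * (ℓ z) ^ (k - 1))) • ℓ : En n →L[ℂ] ℂ)) : En n →ₗ[ℂ] ℂ) v := by
      ext w; simp [LinearMap.transvection]
    rw [h3, LinearMap.transvection.det]
    simp [hv]
  · refine ⟨fun i => MvPolynomial.X i + MvPolynomial.C (c * v i) * (∑ j, MvPolynomial.C (ℓ (eb j)) * MvPolynomial.X j) ^ k,
      fun z i => ?_⟩
    beta_reduce
    rw [clm_eq_sum ℓ z]
    simp [ev, mul_comm, mul_left_comm]
    ring

def Good {n : ℕ} (X : En n → En n) : Prop :=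
  ∀ R ε : ℝ, 0 < ε → ∃ h0 : ℝ, 0 < h0 ∧ ∀ h : ℝ, 0 < h → h < h0 → ∃ S : En n → En n, PS S ∧
    ∀ z, ‖z‖ ≤ R → ‖S z - z - (h : ℂ) • X z‖ ≤ ε * h

lemma Good.limit {n : ℕ} {X : En n → En n}
    (H : ∀ R ε : ℝ, 0 < ε → ∃ Y, Good Y ∧ ∀ z, ‖z‖ ≤ R → ‖Y z - X z‖ ≤ ε) : Good X := by
  intro R ε hε
  obtain ⟨Y, hY, hYX⟩ := H R (ε/2) (half_pos hε)
  obtain ⟨h0, h0p, hh⟩ := hY R (ε/2) (half_pos hε)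
  refine ⟨h0, h0p, fun h hp hlt => ?_⟩
  obtain ⟨S, hS, hSz⟩ := hh h hp hlt
  refine ⟨S, hS, fun z hz => ?_⟩
  have e : S z - z - (h:ℂ) • X z = (S z - z - (h:ℂ) • Y z) + (h:ℂ) • (Y z - X z) := by
    rw [smul_sub]; abel
  rw [e]
  refine (norm_add_le _ _).trans ?_
  rw [norm_smul, Complex.norm_real, Real.norm_of_nonneg hp.le]
  have := hSz z hz
  have := mul_le_mul_of_nonneg_left (hYX z hz) hp.le
  linarith

lemma Good.add {n : ℕ} {X Y : En n → En n} (hX : Good X) (hY : Good Y) (cX : Continuous X)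
    (cY : Continuous Y) : Good (fun z => X z + Y z) := by
  intro R ε hε
  obtain ⟨M, hM0, hM⟩ := exists_bound cY R
  have huc : UniformContinuousOn X (closedBall (0 : En n) (R+1)) :=
    (isCompact_closedBall _ _).uniformContinuousOn_of_continuous cX.continuousOn
  rw [Metric.uniformContinuousOn_iff] at huc
  obtain ⟨δ, hδ, hδX⟩ := huc (ε/4) (by positivity)
  obtain ⟨h1, h1p, hh1⟩ := hX (R+1) (ε/4) (by positivity)
  obtain ⟨h2, h2p, hh2⟩ := hY R (min (ε/4) 1) (by positivity)
  refine ⟨min (min h1 h2) (min (1/(M+1)) (δ/(M+1))), by positivity, fun h hp hlt => ?_⟩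
  rw [lt_min_iff, lt_min_iff, lt_min_iff] at hlt
  obtain ⟨⟨ha, hb⟩, hc, hd⟩ := hlt
  rw [lt_div_iff₀ (by positivity)] at hc hd
  obtain ⟨T, hT, hTz⟩ := hh1 h hp ha
  obtain ⟨S, hS, hSz⟩ := hh2 h hp hb
  refine ⟨fun z => T (S z), hT.comp hS, fun z hz => ?_⟩
  have hnh : ‖(h:ℂ)‖ = h := by rw [Complex.norm_real, Real.norm_of_nonneg hp.le]
  have b1 : ‖S z - z‖ ≤ h * (M + 1) := by
    have e : S z - z = (S z - z - (h:ℂ) • Y z) + (h:ℂ) • Y z := by abel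
    rw [e]
    refine (norm_add_le _ _).trans ?_
    rw [norm_smul, hnh]
    have i1 := hSz z hz
    have i2 := mul_le_mul_of_nonneg_left (hM z hz) hp.le
    have i3 := mul_le_mul_of_nonneg_right (min_le_right (ε/4) 1) hp.le
    linarith
  have b2 : ‖S z‖ ≤ R + 1 := by
    have e : S z = (S z - z) + z := by abel
    rw [e]
    refine (norm_add_le _ _).trans ?_
    linarith
  have b3 : ‖X (S z) - X z‖ ≤ ε / 4 := by
    rw [← dist_eq_norm]
    refine (hδX _ (by simpa using b2) _ (by simp; linarith) ?_).le
    rw [dist_eq_norm]; linarith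
  have e : T (S z) - z - (h:ℂ) • (X z + Y z) = (T (S z) - S z - (h:ℂ) • X (S z)) +
      (h:ℂ) • (X (S z) - X z) + (S z - z - (h:ℂ) • Y z) := by
    rw [smul_sub, smul_add]; abel
  rw [e]
  refine (norm_add₃_le).trans ?_
  rw [norm_smul, hnh]
  have i1 := hSz z hz
  have i2 := mul_le_mul_of_nonneg_left b3 hp.le
  have i3 := mul_le_mul_of_nonneg_right (min_le_left (ε/4) 1) hp.le
  have i4 := hTz _ b2
  nlinarith

lemma good_shear {n : ℕ} (ℓ : En n →L[ℂ] ℂ) (v : En n) (hv : ℓ v = 0) (c : ℂ) (k : ℕ) :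
    Good (fun z => (c * (ℓ z) ^ k) • v) := by
  intro R ε hε
  refine ⟨1, one_pos, fun h hp _ => ⟨_, ps_shear ℓ v hv (h * c) k, fun z hz => ?_⟩⟩
  have : z + (h * c * (ℓ z) ^ k) • v - z - (h:ℂ) • (c * (ℓ z) ^ k) • v = 0 := by
    rw [smul_smul, mul_assoc]; abel
  rw [this, norm_zero]; positivity

lemma good_zero {n : ℕ} : Good (fun _ : En n => (0 : En n)) := by
  simpa using good_shear (n := n) 0 0 (by simp) 0 0

lemma good_sum {n : ℕ} {ι : Type*} (s : Finset ι) (X : ι → En n → En n) (h : ∀ i ∈ s, Good (X i))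
    (hc : ∀ i ∈ s, Continuous (X i)) : Good (fun z => ∑ i ∈ s, X i z) := by
  classical
  induction s using Finset.induction_on with
  | empty => simpa using good_zero
  | insert i s hi ih =>
    simp only [Finset.sum_insert hi]
    refine Good.add (h i (by simp)) (ih (fun j hj => h j (by simp [hj])) (fun j hj => hc j (by simp [hj])))
      (hc i (by simp)) ?_
    exact continuous_finsetSum _ fun j hj => hc j (by simp [hj])


lemma coeff_mem {M : Type*} [AddCommGroup M] [Module ℂ M] (W : Submodule ℂ M) (N : ℕ) (f : ℕ → M)
    (h : ∀ t : ℂ, ∑ j ∈ Finset.range N, t ^ j • f j ∈ W) : ∀ j < N, f j ∈ W := by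
  intro j hj
  by_contra hcon
  obtain ⟨φ, hφ1, hφ2⟩ := Submodule.exists_le_ker_of_notMem hcon
  have key : (∑ i ∈ Finset.range N, Polynomial.C (φ (f i)) * Polynomial.X ^ i : Polynomial ℂ) = 0 := by
    apply Polynomial.funext
    intro t
    have := hφ2 (h t)
    rw [LinearMap.mem_ker, map_sum] at this
    simp only [Polynomial.eval_finsetSum, Polynomial.eval_mul, Polynomial.eval_C, Polynomial.eval_pow,
      Polynomial.eval_X, Polynomial.eval_zero]
    rw [← this]
    refine Finset.sum_congr rfl fun i _ => ?_
    simp [mul_comm]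
  have := congrArg (fun p => Polynomial.coeff p j) key
  simp [Polynomial.coeff_C_mul, Polynomial.coeff_X_pow, hj] at this
  exact hφ1 this

def lf {n : ℕ} (c : Fin n → ℂ) : MvPolynomial (Fin n) ℂ := ∑ j, MvPolynomial.C (c j) * MvPolynomial.X j

lemma lf_add_single {n : ℕ} (c : Fin n → ℂ) (i : Fin n) (t : ℂ) :
    lf (c + Pi.single i t) = lf c + MvPolynomial.C t * MvPolynomial.X i := by
  have h : ∀ j, MvPolynomial.C ((c + Pi.single i t : Fin n → ℂ) j) * MvPolynomial.X j = MvPolynomial.C (c j) * MvPolynomial.X j +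
      (if j = i then MvPolynomial.C t * (MvPolynomial.X i : MvPolynomial (Fin n) ℂ) else 0) := by
    intro j
    by_cases hj : j = i
    · subst hj; simp [add_mul]
    · simp [hj]
  unfold lf
  rw [Finset.sum_congr rfl fun j _ => h j, Finset.sum_add_distrib]
  simp

def VV (n : ℕ) : Submodule ℂ (MvPolynomial (Fin n) ℂ) := Submodule.span ℂ {p | ∃ c k, p = lf c ^ k}

lemma lf_prod_mem {n : ℕ} (m : Fin n → ℕ) (s : Finset (Fin n)) : ∀ (c : Fin n → ℂ) (k : ℕ),
    lf c ^ k * ∏ i ∈ s, MvPolynomial.X i ^ m i ∈ VV n := by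
  classical
  induction s using Finset.induction_on with
  | empty => 
    intro c k
    rw [Finset.prod_empty, mul_one]
    exact Submodule.subset_span (show lf c ^ k ∈ {p | ∃ c k, p = lf c ^ k} from ⟨c, k, rfl⟩)
  | insert i s hi ih =>
    intro c k
    set Q : MvPolynomial (Fin n) ℂ := ∏ i ∈ s, MvPolynomial.X i ^ m i with hQ
    have H := coeff_mem (VV n) (k + m i + 1)
      (fun j => ((k + m i).choose j : ℂ) • (lf c ^ (k + m i - j) * (MvPolynomial.X i ^ j * Q))) (fun t => by
        have := ih (c + Pi.single i t) (k + m i)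
        rw [lf_add_single, add_comm, add_pow, Finset.sum_mul] at this
        convert this using 2 with j hj
        rw [MvPolynomial.smul_eq_C_mul, MvPolynomial.smul_eq_C_mul, mul_pow, ← MvPolynomial.C_pow]
        simp only [map_natCast]
        ring) (m i) (by omega)
    simp only [Nat.add_sub_cancel] at H
    have h2 : ((k + m i).choose (m i) : ℂ) ≠ 0 := by
      exact_mod_cast (Nat.choose_pos (by omega)).ne'
    rw [Submodule.smul_mem_iff _ h2] at H
    rwa [Finset.prod_insert hi]

lemma VV_top {n : ℕ} (p : MvPolynomial (Fin n) ℂ) : p ∈ VV n := by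
  induction p using MvPolynomial.induction_on' with
  | monomial m a =>
    have := (VV n).smul_mem a (lf_prod_mem (fun i => m i) Finset.univ 0 0)
    rw [MvPolynomial.monomial_eq, Finsupp.prod_fintype _ _ (by simp), ← MvPolynomial.smul_eq_C_mul]
    simpa using this
  | add p q hp hq => exact (VV n).add_mem hp hq

def XH {n : ℕ} (a b : Fin n) (P : MvPolynomial (Fin n) ℂ) (z : En n) : En n :=
  ev (MvPolynomial.pderiv b P) z • eb a - ev (MvPolynomial.pderiv a P) z • eb b

lemma XH_cont {n : ℕ} (a b : Fin n) (P : MvPolynomial (Fin n) ℂ) : Continuous (XH a b P) := by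
  have h1 := (ev_diff (MvPolynomial.pderiv b P)).continuous
  have h2 := (ev_diff (MvPolynomial.pderiv a P)).continuous
  exact (h1.smul continuous_const).sub (h2.smul continuous_const)

lemma pderiv_lf {n : ℕ} (c : Fin n → ℂ) (i : Fin n) : MvPolynomial.pderiv i (lf c) = MvPolynomial.C (c i) := by
  simp [lf, MvPolynomial.pderiv_X, Pi.single_apply]

def lfL {n : ℕ} (c : Fin n → ℂ) : En n →L[ℂ] ℂ := ∑ j, c j • (EuclideanSpace.proj j : En n →L[ℂ] ℂ)

lemma lfL_apply {n : ℕ} (c : Fin n → ℂ) (z : En n) : lfL c z = ∑ j, c j * z j := by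
  simp [lfL]

lemma ev_lf {n : ℕ} (c : Fin n → ℂ) (z : En n) : ev (lf c) z = lfL c z := by
  rw [lfL_apply]; simp [ev, lf]

lemma good_XH_lf {n : ℕ} (a b : Fin n) (α : ℂ) (c : Fin n → ℂ) (k : ℕ) : Good (XH a b (α • lf c ^ k)) := by
  have := good_shear (lfL c) (c b • eb a - c a • eb b) (by
    simp [lfL_apply, mul_sub, Finset.sum_sub_distrib, mul_comm]) (α * k) (k-1)
  convert this using 1
  ext1 z
  have e : ∀ i, ev (MvPolynomial.pderiv i (α • lf c ^ k)) z = α * k * (lfL c z) ^ (k-1) * c i := by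
    intro i
    rw [← ev_lf]
    simp [ev, MvPolynomial.pderiv_pow, pderiv_lf, MvPolynomial.smul_eq_C_mul]
    ring
  rw [XH, e, e, smul_sub, smul_smul, smul_smul]

lemma good_XH {n : ℕ} (a b : Fin n) (P : MvPolynomial (Fin n) ℂ) : Good (XH a b P) := by
  suffices h : ∀ α : ℂ, Good (XH a b (α • P)) by simpa using h 1
  have hP := VV_top P
  unfold VV at hP
  induction hP using Submodule.span_induction with
  | mem p hp => obtain ⟨c, k, rfl⟩ := hp; intro α; exact good_XH_lf a b α c k
  | zero => intro α; simpa using good_XH_lf a b 0 0 0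
  | add p q _ _ hp hq =>
    intro α
    have := (hp α).add (hq α) (XH_cont _ _ _) (XH_cont _ _ _)
    convert this using 1
    ext1 z
    simp only [XH, ev, smul_add, map_add, add_smul]
    abel
  | smul r p _ hp => intro α; rw [smul_smul]; exact hp _

lemma pderiv_comm' {n : ℕ} (i j : Fin n) (P : MvPolynomial (Fin n) ℂ) :
    MvPolynomial.pderiv i (MvPolynomial.pderiv j P) = MvPolynomial.pderiv j (MvPolynomial.pderiv i P) := by
  have : ⁅(MvPolynomial.pderiv i : Derivation ℂ (MvPolynomial (Fin n) ℂ) (MvPolynomial (Fin n) ℂ)),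
      (MvPolynomial.pderiv j : Derivation ℂ (MvPolynomial (Fin n) ℂ) (MvPolynomial (Fin n) ℂ))⁆ = 0 := by
    apply MvPolynomial.derivation_ext
    intro k
    simp only [Derivation.commutator_apply, MvPolynomial.pderiv_X, Pi.single_apply]
    split_ifs <;> simp
  have h := congrArg (fun D => D P) this
  simp only [Derivation.commutator_apply, Derivation.coe_zero, Pi.zero_apply] at h
  exact sub_eq_zero.1 h

lemma exists_prim {n : ℕ} (a : Fin n) (P : MvPolynomial (Fin n) ℂ) : ∃ G, MvPolynomial.pderiv a G = P := by
  induction P using MvPolynomial.induction_on' with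
  | monomial m c =>
    refine ⟨MvPolynomial.monomial (m + Finsupp.single a 1) (c / (m a + 1)), ?_⟩
    rw [MvPolynomial.pderiv_monomial]
    have : ((m a : ℂ) + 1) ≠ 0 := Nat.cast_add_one_ne_zero _
    simp [this]
  | add p q hp hq =>
    obtain ⟨G, rfl⟩ := hp
    obtain ⟨H, rfl⟩ := hq
    exact ⟨G + H, by simp⟩

def sub0 {n : ℕ} (a : Fin n) : MvPolynomial (Fin n) ℂ →ₐ[ℂ] MvPolynomial (Fin n) ℂ :=
  MvPolynomial.aeval (fun i => if i = a then 0 else MvPolynomial.X i)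

lemma sub0_pderiv_self {n : ℕ} (a : Fin n) (P : MvPolynomial (Fin n) ℂ) :
    MvPolynomial.pderiv a (sub0 a P) = 0 := by
  induction P using MvPolynomial.induction_on with
  | C c => simp [sub0]
  | add p q hp hq => simp [hp, hq]
  | mul_X p i hp =>
    rw [map_mul, Derivation.leibniz, hp]
    simp only [sub0, MvPolynomial.aeval_X]
    split_ifs with h
    · simp
    · simp [MvPolynomial.pderiv_X, h]

lemma sub0_pderiv {n : ℕ} (a b : Fin n) (hab : a ≠ b) (P : MvPolynomial (Fin n) ℂ) :
    MvPolynomial.pderiv b (sub0 a P) = sub0 a (MvPolynomial.pderiv b P) := by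
  induction P using MvPolynomial.induction_on with
  | C c => simp [sub0]
  | add p q hp hq => simp [hp, hq]
  | mul_X p i hp =>
    rw [map_mul, Derivation.leibniz, hp, Derivation.leibniz]
    simp only [smul_eq_mul, map_add, map_mul]
    congr 2
    simp only [sub0, MvPolynomial.aeval_X, MvPolynomial.pderiv_X, Pi.single_apply]
    by_cases h : i = a
    · subst h; simp [Ne.symm hab, hab]
    · rw [if_neg h, MvPolynomial.pderiv_X]
      by_cases h2 : i = b
      · subst h2; simp
      · simp [h2]

lemma ev_sub0 {n : ℕ} (a : Fin n) (P : MvPolynomial (Fin n) ℂ) (z : En n) :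
    ev (sub0 a P) z = ev P (z - z a • eb a) := by
  unfold ev sub0
  rw [MvPolynomial.aeval_def, ← MvPolynomial.coe_eval₂Hom]
  induction P using MvPolynomial.induction_on with
  | C c => simp
  | add p q hp hq => rw [map_add, map_add, hp, hq, map_add]
  | mul_X p i hp =>
    rw [map_mul, map_mul, hp, map_mul]
    congr 1
    by_cases h : i = a <;> simp [h]


lemma vec_eq_sum {n : ℕ} (z : En n) : z = ∑ j, z j • eb j := by
  simpa using clm_eq_sum (ContinuousLinearMap.id ℂ (En n)) z

lemma DD_add {n : ℕ} (i : Fin n) {u v : En n → ℂ} (hu : Differentiable ℂ u) (hv : Differentiable ℂ v) (z : En n) :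
    DD i (fun w => u w + v w) z = DD i u z + DD i v z := by
  unfold DD
  rw [fderiv_fun_add (hu z) (hv z)]; rfl

lemma DD_sub {n : ℕ} (i : Fin n) {u v : En n → ℂ} (hu : Differentiable ℂ u) (hv : Differentiable ℂ v) (z : En n) :
    DD i (fun w => u w - v w) z = DD i u z - DD i v z := by
  unfold DD
  rw [fderiv_fun_sub (hu z) (hv z)]; rfl

lemma DD_sum {n : ℕ} {ι : Type*} (s : Finset ι) (i : Fin n) {u : ι → En n → ℂ} (hu : ∀ j, Differentiable ℂ (u j)) (z : En n) :
    DD i (fun w => ∑ j ∈ s, u j w) z = ∑ j ∈ s, DD i (u j) z := by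
  unfold DD
  rw [fderiv_fun_sum (fun j _ => hu j z)]; simp

lemma DD_ev {n : ℕ} (i : Fin n) (P : MvPolynomial (Fin n) ℂ) (z : En n) :
    DD i (ev P) z = ev (MvPolynomial.pderiv i P) z := ev_pd P z i

lemma dir_mvt {n : ℕ} (a : Fin n) {q : En n → ℂ} (hq : Differentiable ℂ q) (z : En n) (B : ℝ)
    (hB : ∀ w, ‖w‖ ≤ 2 * ‖z‖ → ‖DD a q w‖ ≤ B) : ‖q z - q (z - z a • eb a)‖ ≤ B * ‖z‖ := by
  have hd : ∀ s : ℂ, HasDerivAt (fun s : ℂ => q (z + s • eb a)) (DD a q (z + s • eb a)) s := by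
    intro s
    have h1 : HasDerivAt (fun s : ℂ => z + s • eb a) (eb a) s := by
      simpa using ((hasDerivAt_id s).smul_const (eb a)).const_add z
    exact (hq _).hasFDerivAt.comp_hasDerivAt s h1
  have := (convex_closedBall (0:ℂ) ‖z‖).norm_image_sub_le_of_norm_hasDerivWithin_le
    (f := fun s : ℂ => q (z + s • eb a)) (f' := fun s => DD a q (z + s • eb a)) (C := B) (x := - z a) (y := 0)
    (fun s _ => (hd s).hasDerivWithinAt) (fun s hs => by
      apply hB
      refine (norm_add_le _ _).trans ?_
      rw [norm_smul, norm_eb, mul_one]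
      have : ‖s‖ ≤ ‖z‖ := by simpa using hs
      linarith) (by simpa using norm_coord_le z a) (by simp)
  simp only [zero_smul, add_zero, neg_smul, zero_sub, norm_neg, neg_neg] at this
  rw [← sub_eq_add_neg] at this
  refine this.trans ?_
  refine mul_le_mul_of_nonneg_left (norm_coord_le z a) ?_
  exact (norm_nonneg _).trans (hB z (by linarith [norm_nonneg z]))

lemma coord_diff {n : ℕ} {X : En n → En n} (hX : Differentiable ℂ X) (i : Fin n) :
    Differentiable ℂ (fun w => X w i) :=
  (EuclideanSpace.proj i : En n →L[ℂ] ℂ).differentiable.comp hX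

lemma good_of_div {n : ℕ} (hn : 2 ≤ n) {X : En n → En n} (hX : Differentiable ℂ X)
    (hdiv : ∀ z, ∑ i, DD i (fun w => X w i) z = 0) : Good X := by
  set a : Fin n := ⟨0, by omega⟩ with ha
  set b : Fin n := ⟨1, by omega⟩ with hb
  have hab : a ≠ b := by simp [ha, hb]
  clear_value a b
  apply Good.limit
  intro R ε hε
  set R1 := max R 1 with hR1
  have hR1p : 1 ≤ R1 := le_max_right _ _
  set δ := ε / (n + 2 * n * R1 + 1) with hδ
  have hδp : 0 < δ := by positivity
  have hA : ∀ j, ∃ P : MvPolynomial (Fin n) ℂ, ∀ z, ‖z‖ ≤ 2 * R1 + 1 → ‖X z j - ev P z‖ ≤ δ :=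
    fun j => polyApprox (coord_diff hX j) _ _ hδp
  choose Q hQ using hA
  choose G hG using fun j => exists_prim a (Q j)
  set q : En n → ℂ := fun z => X z a + ∑ j ∈ Finset.univ.erase a, ev (MvPolynomial.pderiv j (G j)) z with hq
  have hqd : Differentiable ℂ q := by
    refine (coord_diff hX a).add ?_
    exact Differentiable.fun_sum fun j _ => ev_diff _
  have hDq : ∀ z, DD a q z = ∑ j ∈ Finset.univ.erase a, DD j (fun w => ev (Q j) w - X w j) z := by
    intro z
    rw [hq, DD_add a (coord_diff hX a) (Differentiable.fun_sum fun j _ => ev_diff _), DD_sum _ _ (fun j => ev_diff _)]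
    have h1 := hdiv z
    rw [← Finset.add_sum_erase _ _ (Finset.mem_univ a)] at h1
    have h2 : ∀ j, DD j (fun w => ev (Q j) w - X w j) z =
        DD a (ev (MvPolynomial.pderiv j (G j))) z - DD j (fun w => X w j) z := by
      intro j
      rw [DD_sub j (ev_diff _) (coord_diff hX j), DD_ev, DD_ev, pderiv_comm', hG]
    rw [Finset.sum_congr rfl fun j _ => h2 j, Finset.sum_sub_distrib]
    linear_combination h1
  have hcard : ((Finset.univ.erase a).card : ℝ) ≤ n := by
    have := Finset.card_erase_le (s := (Finset.univ : Finset (Fin n))) (a := a)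
    simp only [Finset.card_univ, Fintype.card_fin] at this
    exact_mod_cast this
  have hDqb : ∀ z, ‖z‖ ≤ 2 * R1 → ‖DD a q z‖ ≤ n * (2 * δ) := by
    intro z hz
    rw [hDq]
    refine (norm_sum_le_of_le _ (n := fun _ => 2 * δ) fun j _ => ?_).trans ?_
    · have hc := cauchy_fderiv (u := fun w => ev (Q j) w - X w j) (z := z) (r := 1) (M := δ)
        ((ev_diff _).sub (coord_diff hX j)) one_pos (fun w hw => by
          rw [norm_sub_rev]
          apply hQ
          have h1 : ‖w‖ ≤ ‖w - z‖ + ‖z‖ := by simpa using norm_add_le (w - z) z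
          rw [mem_closedBall, dist_eq_norm] at hw
          linarith)
      have := (fderiv ℂ (fun w => ev (Q j) w - X w j) z).le_opNorm (eb j)
      rw [norm_eb, mul_one] at this
      refine this.trans (hc.trans ?_)
      simp
    · rw [Finset.sum_const, nsmul_eq_mul]
      gcongr
  obtain ⟨P, hP⟩ := polyApprox hqd (2 * R1) δ hδp
  obtain ⟨H0, hH0⟩ := exists_prim b P
  refine ⟨fun z => (∑ j ∈ Finset.univ.erase a, XH a j (- G j) z) + XH a b (sub0 a H0) z, ?_, ?_⟩
  · refine Good.add ?_ (good_XH _ _ _) (continuous_finsetSum _ fun j _ => XH_cont _ _ _) (XH_cont _ _ _)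
    exact good_sum _ _ (fun j _ => good_XH _ _ _) (fun j _ => XH_cont _ _ _)
  intro z hz
  have hz1 : ‖z‖ ≤ R1 := hz.trans (le_max_left _ _)
  have e1 : XH a b (sub0 a H0) z = ev P (z - z a • eb a) • eb a := by
    unfold XH
    rw [sub0_pderiv_self, sub0_pderiv _ _ hab, hH0, ev_sub0]
    simp [ev]
  have e2 : ∀ j, XH a j (- G j) z = ev (Q j) z • eb j - ev (MvPolynomial.pderiv j (G j)) z • eb a := by
    intro j
    unfold XH
    rw [map_neg, map_neg, hG]
    simp only [ev, map_neg, neg_smul]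
    abel
  have e3 : X z = X z a • eb a + ∑ j ∈ Finset.univ.erase a, X z j • eb j := by
    rw [Finset.add_sum_erase _ (fun j => X z j • eb j) (Finset.mem_univ a)]
    exact vec_eq_sum _
  have e4 : (∑ j ∈ Finset.univ.erase a, XH a j (- G j) z) + XH a b (sub0 a H0) z - X z =
      (∑ j ∈ Finset.univ.erase a, (ev (Q j) z - X z j) • eb j) + (ev P (z - z a • eb a) - q z) • eb a := by
    conv_lhs => rw [e3]
    rw [e1, Finset.sum_congr rfl fun j _ => e2 j, Finset.sum_sub_distrib]
    simp only [sub_smul, Finset.sum_sub_distrib, hq, add_smul, Finset.sum_smul]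
    abel
  beta_reduce
  rw [e4]
  refine (norm_add_le _ _).trans ?_
  have b1 : ‖∑ j ∈ Finset.univ.erase a, (ev (Q j) z - X z j) • eb j‖ ≤ n * δ := by
    refine (norm_sum_le_of_le _ (n := fun _ => δ) fun j _ => ?_).trans ?_
    · rw [norm_smul, norm_eb, mul_one, norm_sub_rev]
      exact hQ j z (by linarith)
    · rw [Finset.sum_const, nsmul_eq_mul]
      gcongr
  have b2 : ‖q z - q (z - z a • eb a)‖ ≤ n * (2 * δ) * R1 := by
    refine (dir_mvt a hqd z (n * (2 * δ)) fun w hw => hDqb w (by linarith)).trans ?_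
    gcongr
  have b3 : ‖q (z - z a • eb a) - ev P (z - z a • eb a)‖ ≤ δ := by
    apply hP
    refine (norm_sub_le _ _).trans ?_
    rw [norm_smul, norm_eb, mul_one]
    have := norm_coord_le z a
    linarith
  rw [norm_smul, norm_eb, mul_one, norm_sub_rev]
  have b4 : ‖q z - ev P (z - z a • eb a)‖ ≤ n * (2 * δ) * R1 + δ := by
    refine (norm_sub_le_norm_sub_add_norm_sub _ (q (z - z a • eb a)) _).trans (add_le_add b2 b3)
  have hfin : n * δ + (n * (2 * δ) * R1 + δ) = ε := by
    rw [hδ]; field_simp; ring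
  linarith


lemma det_eq_mat {n : ℕ} (B : En n →L[ℂ] En n) :
    B.det = Matrix.det (Matrix.of fun i j => (B (eb j)) i) := by
  unfold ContinuousLinearMap.det
  rw [← LinearMap.det_toMatrix (EuclideanSpace.basisFun (Fin n) ℂ).toBasis]
  congr 1

lemma det_diff {n : ℕ} : Differentiable ℂ (fun m : Fin n → Fin n → ℂ => Matrix.det (Matrix.of m)) := by
  simp only [Matrix.det_apply, Matrix.of_apply]
  fun_prop

lemma trace_zero {n : ℕ} (A : ℂ → Fin n → Fin n → ℂ) (A' : Fin n → Fin n → ℂ) (hA : HasDerivAt A A' 0)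
    (h0 : A 0 = fun i j => if i = j then 1 else 0) (hdet : ∀ s, Matrix.det (Matrix.of (A s)) = 1) :
    ∑ i, A' i i = 0 := by
  set I : Fin n → Fin n → ℂ := fun i j => if i = j then 1 else 0 with hI
  have hIm : Matrix.of I = 1 := by ext i j; simp [hI, Matrix.one_apply]
  have h1 := (det_diff (A 0)).hasFDerivAt.comp_hasDerivAt (0:ℂ) hA
  have h2 : HasDerivAt (fun s => Matrix.det (Matrix.of (A s))) 0 0 := by
    simp only [hdet]; exact hasDerivAt_const _ _
  have h3 := h2.unique h1
  have hB : HasDerivAt (fun s : ℂ => I + s • A') A' 0 := by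
    simpa using ((hasDerivAt_id (0:ℂ)).smul_const A').const_add I
  have h4 : HasDerivAt (fun s : ℂ => Matrix.det (Matrix.of (I + s • A')))
      ((fderiv ℂ (fun m : Fin n → Fin n → ℂ => Matrix.det (Matrix.of m)) (A 0)) A') 0 := by
    have := (det_diff (I + (0:ℂ) • A')).hasFDerivAt.comp_hasDerivAt (0:ℂ) hB
    rw [zero_smul, add_zero] at this
    rw [h0]
    exact this
  rw [← h3] at h4
  have h5 : ∀ s : ℂ, Matrix.det (Matrix.of (I + s • A')) = 
    1 + Matrix.trace (Matrix.of A') * s + Polynomial.eval s (Matrix.det (1 + (Polynomial.X : Polynomial ℂ) • (Matrix.of A').map Polynomial.C)).divX.divX * s ^ 2 := by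
    intro s
    rw [← Matrix.det_one_add_smul, ← hIm]
    rfl
  simp only [h5] at h4
  set p := (Matrix.det (1 + (Polynomial.X : Polynomial ℂ) • (Matrix.of A').map Polynomial.C)).divX.divX
  have h6 : HasDerivAt (fun s : ℂ => 1 + Matrix.trace (Matrix.of A') * s + Polynomial.eval s p * s ^ 2)
     (Matrix.trace (Matrix.of A')) 0 := by
    have := (((hasDerivAt_id (0:ℂ)).const_mul (Matrix.trace (Matrix.of A'))).const_add 1).add
       ((p.hasDerivAt 0).mul ((hasDerivAt_id (0:ℂ)).pow 2))
    refine HasDerivAt.congr_deriv this ?_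
    simp
  have := h4.unique h6
  simpa [Matrix.trace] using this.symm

lemma snd_symm {n : ℕ} {f : En n → En n} (hf : Differentiable ℂ f) (x v w : En n) :
    fderiv ℂ (fderiv ℂ f) x v w = fderiv ℂ (fderiv ℂ f) x w v :=
  second_derivative_symmetric (fun y => (hf y).hasFDerivAt) ((diff_fderiv hf) x).hasFDerivAt v w

def ZZ {n : ℕ} (f g : En n → En n) (y : En n) : En n := fderiv ℂ f (g y) (g y) - y

lemma ZZ_hasFDerivAt {n : ℕ} {f g : En n → En n} (hf : Differentiable ℂ f) (hg : Differentiable ℂ g)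
    (hfg : Function.RightInverse g f) (y : En n) :
    HasFDerivAt (ZZ f g) ((fderiv ℂ (fderiv ℂ f) (g y) (g y)).comp (fderiv ℂ g y)) y := by
  have h1 : HasFDerivAt (fun y => fderiv ℂ f (g y)) ((fderiv ℂ (fderiv ℂ f) (g y)).comp (fderiv ℂ g y)) y :=
    ((diff_fderiv hf) (g y)).hasFDerivAt.comp y (hg y).hasFDerivAt
  have h2 := (h1.clm_apply (hg y).hasFDerivAt).sub (hasFDerivAt_id y)
  refine h2.congr_fderiv ?_
  have h3 : (fderiv ℂ f (g y)).comp (fderiv ℂ g y) = ContinuousLinearMap.id ℂ _ := by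
    have := (hf (g y)).hasFDerivAt.comp y (hg y).hasFDerivAt
    have e : f ∘ g = id := funext hfg
    rw [e] at this
    exact this.unique (hasFDerivAt_id y)
  rw [h3]
  ext1 v
  simp [snd_symm hf (g y) (g y)]

lemma ZZ_div {n : ℕ} {f g : En n → En n} (hf : Differentiable ℂ f) (hg : Differentiable ℂ g)
    (hfg : Function.RightInverse g f) (hdet : IsVolPres f) (y : En n) :
    ∑ i, DD i (fun w => ZZ f g w i) y = 0 := by
  have hZ := ZZ_hasFDerivAt hf hg hfg y
  have h3 : (fderiv ℂ f (g y)).comp (fderiv ℂ g y) = ContinuousLinearMap.id ℂ _ := by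
    have := (hf (g y)).hasFDerivAt.comp y (hg y).hasFDerivAt
    have e : f ∘ g = id := funext hfg
    rw [e] at this
    exact this.unique (hasFDerivAt_id y)
  have hdg : (fderiv ℂ g y).det = 1 := by
    have h4 := congrArg ContinuousLinearMap.det h3
    have h5 := hdet (g y)
    unfold ContinuousLinearMap.det at h4 h5 ⊢
    rw [ContinuousLinearMap.toLinearMap_comp, LinearMap.det_comp, h5, one_mul] at h4
    rw [h4]; simp
  set M : ℂ → (En n →L[ℂ] En n) := fun s => (fderiv ℂ f (g y + s • g y)).comp (fderiv ℂ g y) with hM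
  have hMd : HasDerivAt M ((fderiv ℂ (fderiv ℂ f) (g y) (g y)).comp (fderiv ℂ g y)) 0 := by
    have l : HasDerivAt (fun s : ℂ => g y + s • g y) (g y) 0 := by
      simpa using ((hasDerivAt_id (0:ℂ)).smul_const (g y)).const_add (g y)
    have l2 : HasDerivAt (fun s : ℂ => fderiv ℂ f (g y + s • g y)) (fderiv ℂ (fderiv ℂ f) (g y) (g y)) 0 := by
      have := ((diff_fderiv hf) (g y + (0:ℂ) • g y)).hasFDerivAt.comp_hasDerivAt (0:ℂ) l
      rw [zero_smul, add_zero] at this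
      exact this
    simpa using l2.clm_comp (hasDerivAt_const (0:ℂ) (fderiv ℂ g y))
  have key := trace_zero (fun s i j => (M s (eb j)) i)
    (fun i j => (((fderiv ℂ (fderiv ℂ f) (g y) (g y)).comp (fderiv ℂ g y)) (eb j)) i) ?_ ?_ ?_
  · rw [← key]
    refine Finset.sum_congr rfl fun i _ => ?_
    unfold DD
    have := ((EuclideanSpace.proj i : En n →L[ℂ] ℂ).hasFDerivAt).comp y hZ
    have h' : HasFDerivAt (fun w => ZZ f g w i) _ y := this
    rw [h'.fderiv]
    simp
  · rw [hasDerivAt_pi]; intro i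
    rw [hasDerivAt_pi]; intro j
    have := hMd.clm_apply (hasDerivAt_const (0:ℂ) (eb j))
    have h2 := ((EuclideanSpace.proj i : En n →L[ℂ] ℂ).hasFDerivAt).comp_hasDerivAt (0:ℂ) this
    refine HasDerivAt.congr_deriv h2 ?_
    simp
  · ext i j
    simp only [hM, zero_smul, add_zero, h3]
    simp
  · intro s
    rw [← det_eq_mat, hM]
    have h5 := hdet (g y + s • g y)
    unfold ContinuousLinearMap.det at h5 hdg ⊢
    rw [ContinuousLinearMap.toLinearMap_comp, LinearMap.det_comp, h5, hdg, one_mul]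


lemma ps_id {n : ℕ} : PS (fun z : En n => z) := by
  have := ps_affine (n := n) 0 (ContinuousLinearMap.id ℂ _) (by simp [ContinuousLinearMap.det])
  simpa using this

lemma density_abstract {n : ℕ} (φ X : ℝ → En n → En n) (R : ℝ)
    (F1 : ∃ C : ℝ, 0 ≤ C ∧ ∀ t : ℝ, 0 < t → t ≤ 1 → ∀ z, ‖z‖ ≤ R → ‖φ t z - z‖ ≤ C * t)
    (F2 : ∀ K : ℝ, ∃ L : ℝ, 0 ≤ L ∧ ∀ t : ℝ, 0 < t → t ≤ 1 → ∀ v w, ‖v‖ ≤ K → ‖w‖ ≤ K →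
      ‖X t v - X t w‖ ≤ L * ‖v - w‖)
    (F3 : ∀ t : ℝ, 0 < t → t ≤ 1 → Good (X t))
    (F4 : ∀ τ : ℝ, 0 < τ → ∃ K : ℝ, 0 ≤ K ∧ ∀ s ∈ Icc τ 1, ∀ t ∈ Icc τ 1, ∀ z, ‖z‖ ≤ R →
      ‖φ s z - φ t z‖ ≤ K * |s - t|)
    (F5 : ∀ t : ℝ, 0 < t → ∀ η : ℝ, 0 < η → ∃ h0 : ℝ, 0 < h0 ∧ ∀ h : ℝ, 0 < h → h < h0 → ∀ z, ‖z‖ ≤ R →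
      ‖φ (t + h) z - φ t z - (h : ℂ) • X t (φ t z)‖ ≤ η * h) (ε : ℝ) (hε : 0 < ε) :
    ∃ S, PS S ∧ ∀ z, ‖z‖ ≤ R → ‖φ 1 z - S z‖ ≤ ε := by
  obtain ⟨C, hC0, hC⟩ := F1
  set A : ℝ → Set ℝ := fun t => {r | 0 ≤ r ∧ ∃ S, PS S ∧ ∀ z, ‖z‖ ≤ R → ‖φ t z - S z‖ ≤ r} with hA
  set D : ℝ → ℝ := fun t => sInf (A t) with hD
  have hbdd : ∀ t, BddBelow (A t) := fun t => ⟨0, fun r hr => hr.1⟩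
  have hDle : ∀ t r, 0 ≤ r → (∃ S, PS S ∧ ∀ z, ‖z‖ ≤ R → ‖φ t z - S z‖ ≤ r) → D t ≤ r :=
    fun t r h0 h => csInf_le (hbdd t) ⟨h0, h⟩
  have hmem : ∀ t, 0 < t → t ≤ 1 → C * t ∈ A t := fun t h0 h1 =>
    ⟨by positivity, _, ps_id, fun z hz => hC t h0 h1 z hz⟩
  have hDC : ∀ t, 0 < t → t ≤ 1 → D t ≤ C * t := fun t h0 h1 => csInf_le (hbdd t) (hmem t h0 h1)
  have hDn : ∀ t, 0 < t → t ≤ 1 → 0 ≤ D t := fun t h0 h1 => le_csInf ⟨_, hmem t h0 h1⟩ (fun r hr => hr.1)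
  have hDlt : ∀ t, 0 < t → t ≤ 1 → ∀ r, D t < r → ∃ S, PS S ∧ ∀ z, ‖z‖ ≤ R → ‖φ t z - S z‖ ≤ r := by
    intro t h0 h1 r hr
    obtain ⟨r', ⟨_, S, hS, hS'⟩, hr'⟩ := exists_lt_of_csInf_lt ⟨_, hmem t h0 h1⟩ hr
    exact ⟨S, hS, fun z hz => (hS' z hz).trans hr'.le⟩
  obtain ⟨L, hL0, hL⟩ := F2 (R + 2 * C + 1)
  set τ : ℝ := min 1 (ε / 2 / ((C + 1) * Real.exp L)) with hτ
  have hτ0 : 0 < τ := by positivity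
  have hτ1 : τ ≤ 1 := min_le_left _ _
  have hτ2 : τ * ((C + 1) * Real.exp L) ≤ ε / 2 := by
    rw [← le_div_iff₀ (by positivity)]; exact min_le_right _ _
  obtain ⟨K, hK0, hK⟩ := F4 τ hτ0
  have hcont : ContinuousOn D (Icc τ 1) := by
    have hone : ∀ s ∈ Icc τ 1, ∀ t ∈ Icc τ 1, D s ≤ D t + K * dist s t := by
      intro s hs t ht
      have t0 := hτ0.trans_le ht.1
      refine le_of_forall_pos_le_add fun e he => ?_
      obtain ⟨S, hS, hS'⟩ := hDlt t t0 ht.2 (D t + e) (by linarith)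
      refine hDle s _ ?_ ⟨S, hS, fun z hz => ?_⟩
      · have := hDn t t0 ht.2
        have := dist_nonneg (x := s) (y := t)
        positivity
      · have h1 := hK s hs t ht z hz
        have h2 := hS' z hz
        rw [Real.dist_eq]
        have h3 := norm_sub_le_norm_sub_add_norm_sub (φ s z) (φ t z) (S z)
        linarith
    have : LipschitzOnWith ⟨K, hK0⟩ D (Icc τ 1) := LipschitzOnWith.of_le_add_mul _ hone
    exact this.continuousOn
  have G := le_gronwallBound_of_liminf_deriv_right_le (f := D) (f' := fun t => L * D t) (δ := C * τ) (K := L)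
    (ε := 0) (a := τ) (b := 1) hcont ?_ (hDC τ hτ0 hτ1) (fun t _ => by simp)
  · have := G 1 ⟨hτ1, le_rfl⟩
    rw [gronwallBound_ε0] at this
    apply hDlt 1 one_pos le_rfl
    refine this.trans_lt ?_
    have e1 : Real.exp (L * (1 - τ)) ≤ Real.exp L := by
      apply Real.exp_le_exp.2; nlinarith
    have : C * τ * Real.exp (L * (1 - τ)) ≤ (C + 1) * τ * Real.exp L := by
      gcongr; linarith
    linarith
  · intro t ht r hr
    have t0 := hτ0.trans_le ht.1
    have hDt0 := hDn t t0 ht.2.le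
    have hDtC := hDC t t0 ht.2.le
    have hDtC' : D t ≤ C := hDtC.trans (by nlinarith [ht.2])
    obtain ⟨η, hη0, hη1, hηr⟩ : ∃ η : ℝ, 0 < η ∧ η ≤ 1 ∧ L * D t + (3 + L) * η < r := by
      refine ⟨min 1 ((r - L * D t) / 2 / (3 + L)), by have := sub_pos.2 hr; positivity, min_le_left _ _, ?_⟩
      have h1 := min_le_right 1 ((r - L * D t) / 2 / (3 + L))
      rw [le_div_iff₀ (by positivity)] at h1
      linarith
    obtain ⟨h1, h1p, H1⟩ := F5 t t0 η hη0
    obtain ⟨h2, h2p, H2⟩ := F3 t t0 ht.2.le (R + 2 * C + 1) η hη0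
    apply Eventually.frequently
    have hev : Ioo t (t + min (min h1 h2) 1) ∈ 𝓝[>] t := Ioo_mem_nhdsGT (by
      have : 0 < min (min h1 h2) 1 := by positivity
      linarith)
    filter_upwards [hev] with s hs
    obtain ⟨h, rfl⟩ : ∃ h, s = t + h := ⟨s - t, by ring⟩
    have hp : 0 < h := by linarith [hs.1]
    have hlt : h < min (min h1 h2) 1 := by linarith [hs.2]
    rw [lt_min_iff, lt_min_iff] at hlt
    obtain ⟨⟨ha, hb⟩, hc⟩ := hlt
    obtain ⟨S, hS, hS'⟩ := hDlt t t0 ht.2.le (D t + η * h) (by have := mul_pos hη0 hp; linarith)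
    obtain ⟨T, hT, hT'⟩ := H2 h hp hb
    have hηh : η * h ≤ 1 := by nlinarith
    have key : D (t + h) ≤ D t + h * (L * D t + (3 + L) * η) := by
      refine hDle _ _ (by positivity) ⟨_, hT.comp hS, fun z hz => ?_⟩
      have a1 := H1 h hp ha z hz
      have a2 := hS' z hz
      have a0 := hC t t0 ht.2.le z hz
      have b0 : ‖φ t z‖ ≤ R + C := by
        have : ‖φ t z‖ ≤ ‖φ t z - z‖ + ‖z‖ := by simpa using norm_add_le (φ t z - z) z
        nlinarith [ht.2]
      have b1 : ‖S z‖ ≤ R + 2 * C + 1 := by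
        have : ‖S z‖ ≤ ‖φ t z‖ + ‖φ t z - S z‖ := by
          have := norm_sub_le (φ t z) (φ t z - S z); rwa [sub_sub_cancel] at this
        linarith
      have a3 := hL t t0 ht.2.le (φ t z) (S z) (by linarith) b1
      have a4 := hT' (S z) b1
      have hnh : ‖(h:ℂ)‖ = h := by rw [Complex.norm_real, Real.norm_of_nonneg hp.le]
      have e : φ (t + h) z - T (S z) = (φ (t + h) z - φ t z - (h : ℂ) • X t (φ t z)) + (φ t z - S z)
        + (h:ℂ) • (X t (φ t z) - X t (S z)) - (T (S z) - S z - (h:ℂ) • X t (S z)) := by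
        rw [smul_sub]; abel
      rw [e]
      refine (norm_sub_le _ _).trans ?_
      have := norm_add₃_le (a := φ (t + h) z - φ t z - (h : ℂ) • X t (φ t z)) (b := φ t z - S z)
        (c := (h:ℂ) • (X t (φ t z) - X t (S z)))
      rw [norm_smul, hnh] at this
      have c1 : ‖X t (φ t z) - X t (S z)‖ ≤ L * (D t + η) := by
        refine a3.trans (mul_le_mul_of_nonneg_left (a2.trans ?_) hL0)
        nlinarith
      have c2 := mul_le_mul_of_nonneg_left c1 hp.le
      nlinarith
    have e : t + h - t = h := by ring
    rw [e, inv_mul_lt_iff₀ hp]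
    have := mul_lt_mul_of_pos_left hηr hp
    linarith


lemma quad_bound {n : ℕ} {F : Type*} [NormedAddCommGroup F] [NormedSpace ℂ F] [FiniteDimensional ℂ F]
    {u : En n → F} (hu : Differentiable ℂ u)
    (h0 : u 0 = 0) (h1 : fderiv ℂ u 0 = 0) (R : ℝ) : ∃ C : ℝ, 0 < C ∧ ∀ w, ‖w‖ ≤ R →
      ‖fderiv ℂ u w‖ ≤ C * ‖w‖ ∧ ‖u w‖ ≤ C * ‖w‖ ^ 2 := by
  obtain ⟨C, hC0, hC⟩ := exists_bound (diff_fderiv (diff_fderiv hu)).continuous R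
  have A : ∀ w, ‖w‖ ≤ R → ‖fderiv ℂ u w‖ ≤ C * ‖w‖ := by
    intro w hw
    have := (convex_closedBall (0 : En n) R).norm_image_sub_le_of_norm_fderiv_le (𝕜 := ℂ) (f := fderiv ℂ u) (C := C)
      (x := 0) (y := w) (fun x _ => diff_fderiv hu x) (fun x hx => hC x (by simpa using hx))
      (by simpa using (norm_nonneg w).trans hw) (by simpa using hw)
    simpa [h1] using this
  refine ⟨C, hC0, fun w hw => ⟨A w hw, ?_⟩⟩
  have := (convex_closedBall (0 : En n) ‖w‖).norm_image_sub_le_of_norm_fderiv_le (𝕜 := ℂ) (f := u) (C := C * ‖w‖)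
      (x := 0) (y := w) (fun x _ => hu x) (fun x hx => by
        have hx' : ‖x‖ ≤ ‖w‖ := by simpa using hx
        exact (A x (hx'.trans hw)).trans (by gcongr))
      (by simp) (by simp)
  simp only [h0, sub_zero] at this
  rw [pow_two, ← mul_assoc]; exact this

def ft {n : ℕ} (f : En n → En n) (t : ℝ) (z : En n) : En n := (t:ℂ)⁻¹ • f ((t:ℂ) • z)
def Xt {n : ℕ} (Z : En n → En n) (t : ℝ) (w : En n) : En n := ((t:ℂ) ^ 2)⁻¹ • Z ((t:ℂ) • w)
def psi {n : ℕ} (f Z : En n → En n) (p : ℝ × En n) : En n := ((p.1:ℂ) ^ 2)⁻¹ • Z (f ((p.1:ℂ) • p.2))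

lemma psi_eq {n : ℕ} (f Z : En n → En n) (t : ℝ) (ht : t ≠ 0) (z : En n) :
    psi f Z (t, z) = Xt Z t (ft f t z) := by
  have : (t:ℂ) ≠ 0 := by exact_mod_cast ht
  simp [psi, Xt, ft, smul_smul, this]

lemma psi_cont {n : ℕ} {f Z : En n → En n} (hf : Differentiable ℂ f) (hZ : Differentiable ℂ Z) :
    ContinuousOn (psi f Z) (Ioi 0 ×ˢ univ) := by
  have h1 : Continuous fun p : ℝ × En n => Z (f ((p.1:ℂ) • p.2)) := by
    refine hZ.continuous.comp (hf.continuous.comp ?_)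
    exact (Complex.continuous_ofReal.comp continuous_fst).smul continuous_snd
  have h2 : ContinuousOn (fun p : ℝ × En n => ((p.1:ℂ) ^ 2)⁻¹) (Ioi 0 ×ˢ univ) := by
    refine ContinuousOn.inv₀ (((Complex.continuous_ofReal.comp continuous_fst).pow 2).continuousOn) ?_
    intro p hp
    have : p.1 ≠ 0 := ne_of_gt hp.1
    exact pow_ne_zero _ (by exact_mod_cast this)
  exact h2.smul h1.continuousOn

lemma ft_hasDeriv {n : ℕ} {f g : En n → En n} (hf : Differentiable ℂ f) 
    (hgf : Function.LeftInverse g f) (t : ℝ) (ht : 0 < t) (z : En n) :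
    HasDerivAt (fun s => ft f s z) (psi f (ZZ f g) (t, z)) t := by
  have ht' : (t:ℂ) ≠ 0 := by exact_mod_cast ht.ne'
  have h1 : HasDerivAt (fun s : ℂ => s • z) z (t:ℂ) := by
    simpa using (hasDerivAt_id (t:ℂ)).smul_const z
  have h2 := (hf ((t:ℂ) • z)).hasFDerivAt.comp_hasDerivAt (t:ℂ) h1
  have h3 := (hasDerivAt_inv ht').smul h2
  have h4 := h3.scomp_of_eq t (Complex.ofRealCLM.hasDerivAt (x := t)) rfl
  refine HasDerivAt.congr_deriv h4 ?_
  simp only [psi, ZZ, hgf _, map_smul, Function.comp, Complex.ofRealCLM_apply, Complex.ofReal_one, one_smul]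
  rw [smul_sub, smul_smul, neg_smul, sub_eq_add_neg]
  congr 2
  field_simp

lemma F4F5 {n : ℕ} {f g : En n → En n} (hf : Differentiable ℂ f) (hZ : Differentiable ℂ (ZZ f g))
    (hgf : Function.LeftInverse g f) (R : ℝ) :
    (∀ τ : ℝ, 0 < τ → ∃ K : ℝ, 0 ≤ K ∧ ∀ s ∈ Icc τ 1, ∀ t ∈ Icc τ 1, ∀ z, ‖z‖ ≤ R →
      ‖ft f s z - ft f t z‖ ≤ K * |s - t|) ∧
    (∀ t : ℝ, 0 < t → ∀ η : ℝ, 0 < η → ∃ h0 : ℝ, 0 < h0 ∧ ∀ h : ℝ, 0 < h → h < h0 → ∀ z, ‖z‖ ≤ R →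
      ‖ft f (t + h) z - ft f t z - (h : ℂ) • Xt (ZZ f g) t (ft f t z)‖ ≤ η * h) := by
  constructor
  · intro τ hτ
    have hc : IsCompact (Icc τ 1 ×ˢ closedBall (0 : En n) R) := isCompact_Icc.prod (isCompact_closedBall _ _)
    obtain ⟨K, hK⟩ := hc.exists_bound_of_continuousOn ((psi_cont hf hZ).mono (fun p hp =>
      ⟨hτ.trans_le hp.1.1, mem_univ _⟩))
    refine ⟨max K 0, le_max_right _ _, fun s hs t ht z hz => ?_⟩
    have := (convex_Icc τ 1).norm_image_sub_le_of_norm_hasDerivWithin_le (f := fun s => ft f s z)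
      (f' := fun s => psi f (ZZ f g) (s, z)) (C := max K 0) (x := t) (y := s)
      (fun x hx => (ft_hasDeriv hf hgf x (hτ.trans_le hx.1) z).hasDerivWithinAt)
      (fun x hx => (hK (x, z) ⟨hx, by simpa using hz⟩).trans (le_max_left _ _)) ht hs
    simpa using this
  · intro t ht η hη
    have hc : IsCompact (Icc t (t+1) ×ˢ closedBall (0 : En n) R) := isCompact_Icc.prod (isCompact_closedBall _ _)
    have huc := hc.uniformContinuousOn_of_continuous ((psi_cont hf hZ).mono (fun p hp =>
      ⟨ht.trans_le hp.1.1, mem_univ _⟩))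
    rw [Metric.uniformContinuousOn_iff] at huc
    obtain ⟨δ, hδ, hu⟩ := huc η hη
    refine ⟨min δ 1, by positivity, fun h hp hlt z hz => ?_⟩
    rw [lt_min_iff] at hlt
    have hd : ∀ x ∈ Icc t (t+h), HasDerivWithinAt (fun s => ft f s z - ((s:ℂ)) • psi f (ZZ f g) (t, z))
        (psi f (ZZ f g) (x, z) - psi f (ZZ f g) (t, z)) (Icc t (t+h)) x := by
      intro x hx
      have h1 := (ft_hasDeriv hf hgf x (ht.trans_le hx.1) z)
      have h2 := ((Complex.ofRealCLM.hasDerivAt (x := x)).smul_const (psi f (ZZ f g) (t, z)))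
      refine (HasDerivAt.congr_deriv (h1.sub h2) ?_).hasDerivWithinAt
      simp
    have := (convex_Icc t (t+h)).norm_image_sub_le_of_norm_hasDerivWithin_le (C := η) (x := t) (y := t + h)
      hd (fun x hx => by
        rw [← dist_eq_norm]
        refine (hu _ ⟨⟨hx.1, by linarith [hx.2]⟩, by simpa using hz⟩ _ ⟨⟨le_rfl, by linarith⟩, by simpa using hz⟩ ?_).le
        rw [Prod.dist_eq, dist_self, max_lt_iff]
        refine ⟨?_, hδ⟩
        rw [Real.dist_eq, abs_lt]; constructor <;> linarith [hx.1, hx.2])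
      ⟨le_rfl, by linarith⟩ ⟨by linarith, le_rfl⟩
    rw [← psi_eq f _ t ht.ne' z]
    have e : ft f (t + h) z - ft f t z - (h : ℂ) • psi f (ZZ f g) (t, z) =
       (ft f (t + h) z - ((t+h : ℝ):ℂ) • psi f (ZZ f g) (t, z)) - (ft f t z - (t:ℂ) • psi f (ZZ f g) (t, z)) := by
      push_cast; rw [add_smul]; abel
    rw [e]
    refine this.trans ?_
    rw [add_sub_cancel_left, Real.norm_of_nonneg hp.le]

lemma density_normalized {n : ℕ} (hn : 2 ≤ n) {f : En n → En n} (hf : IsHoloAut f) (hv : IsVolPres f) (h0 : f 0 = 0)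
    (h1 : fderiv ℂ f 0 = ContinuousLinearMap.id ℂ _) (R ε : ℝ) (hε : 0 < ε) :
    ∃ S, PS S ∧ ∀ z, ‖z‖ ≤ R → ‖f z - S z‖ ≤ ε := by
  obtain ⟨df, g, dg, hgf, hfg⟩ := hf
  have hg0 : g 0 = 0 := by simpa [h0] using hgf 0
  have dZ : Differentiable ℂ (ZZ f g) := fun y => (ZZ_hasFDerivAt df dg hfg y).differentiableAt
  have hZ0 : ZZ f g 0 = 0 := by simp [ZZ, hg0]
  have hZ1 : fderiv ℂ (ZZ f g) 0 = 0 := by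
    rw [(ZZ_hasFDerivAt df dg hfg 0).fderiv, hg0]; simp
  obtain ⟨F4, F5⟩ := F4F5 df dZ hgf R
  have := density_abstract (ft f) (Xt (ZZ f g)) R ?_ ?_ ?_ F4 F5 ε hε
  · simpa [ft] using this
  · obtain ⟨C, hC0, hC⟩ := quad_bound (u := fun z => f z - z) (df.sub differentiable_id) (by simp [h0])
      (by rw [fderiv_fun_sub (df 0) differentiableAt_fun_id, h1]; simp) R
    refine ⟨C * R ^ 2, by positivity, fun t t0 t1 z hz => ?_⟩
    have hnt : ‖(t:ℂ)‖ = t := by rw [Complex.norm_real, Real.norm_of_nonneg t0.le]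
    have ht' : (t:ℂ) ≠ 0 := by exact_mod_cast t0.ne'
    have e : ft f t z - z = (t:ℂ)⁻¹ • (f ((t:ℂ) • z) - (t:ℂ) • z) := by
      rw [smul_sub, smul_smul, inv_mul_cancel₀ ht', one_smul]; rfl
    have hb := (hC ((t:ℂ) • z) (by
      rw [norm_smul, hnt]; nlinarith [norm_nonneg z])).2
    rw [e, norm_smul, norm_inv, hnt, inv_mul_le_iff₀ t0]
    refine hb.trans ?_
    rw [norm_smul, hnt]
    have : ‖z‖ ^ 2 ≤ R ^ 2 := by gcongr
    nlinarith [mul_pos hC0 (mul_pos t0 t0)]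
  · intro K
    obtain ⟨C, hC0, hC⟩ := quad_bound dZ hZ0 hZ1 (max K 0)
    refine ⟨C * max K 0, by positivity, fun t t0 t1 v w hv hw => ?_⟩
    have hnt : ‖(t:ℂ)‖ = t := by rw [Complex.norm_real, Real.norm_of_nonneg t0.le]
    have m := (convex_closedBall (0 : En n) (t * max K 0)).norm_image_sub_le_of_norm_fderiv_le (𝕜 := ℂ)
      (f := ZZ f g) (C := C * (t * max K 0))
      (x := (t:ℂ) • w) (y := (t:ℂ) • v) (fun x _ => dZ x) (fun x hx => by
        have hx' : ‖x‖ ≤ t * max K 0 := by simpa using hx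
        have := (hC x (hx'.trans (by nlinarith [le_max_right K 0]))).1
        exact this.trans (by gcongr))
      (by rw [mem_closedBall_zero_iff, norm_smul, hnt]; gcongr; exact hw.trans (le_max_left _ _))
      (by rw [mem_closedBall_zero_iff, norm_smul, hnt]; gcongr; exact hv.trans (le_max_left _ _))
    unfold Xt
    rw [← smul_sub, norm_smul, norm_inv, norm_pow, hnt, inv_mul_le_iff₀ (by positivity)]
    refine m.trans (le_of_eq ?_)
    rw [← smul_sub, norm_smul, hnt]; ring
  · intro t t0 t1
    have ht' : (t:ℂ) ≠ 0 := by exact_mod_cast t0.ne'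
    have hl : Differentiable ℂ (fun w : En n => (t:ℂ) • w) := by fun_prop
    refine good_of_div hn ((dZ.comp hl).const_smul (((t:ℂ) ^ 2)⁻¹)) fun z => ?_
    have key := ZZ_div df dg hfg hv ((t:ℂ) • z)
    have : ∀ i, DD i (fun w => Xt (ZZ f g) t w i) z = (((t:ℂ)^2)⁻¹ * t) * DD i (fun w => ZZ f g w i) ((t:ℂ) • z) := by
      intro i
      unfold DD
      have hh : HasFDerivAt (fun w : En n => (t:ℂ) • w) ((t:ℂ) • ContinuousLinearMap.id ℂ (En n)) z :=
        (hasFDerivAt_id z).const_smul (t:ℂ)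
      have h2 := ((coord_diff dZ i ((t:ℂ) • z)).hasFDerivAt.comp z hh).const_mul (((t:ℂ)^2)⁻¹)
      have h3 : HasFDerivAt (fun w => Xt (ZZ f g) t w i) _ z := h2
      rw [h3.fderiv]
      simp [mul_assoc]
    change ∑ i, DD i (fun w => Xt (ZZ f g) t w i) z = 0
    rw [Finset.sum_congr rfl fun i _ => this i, ← Finset.mul_sum, key, mul_zero]

lemma density {n : ℕ} (hn : 2 ≤ n) {f : En n → En n} (hf : IsHoloAut f) (hv : IsVolPres f)
    (R ε : ℝ) (hε : 0 < ε) :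
    ∃ S, PS S ∧ ∀ z, ‖z‖ ≤ R → ‖f z - S z‖ ≤ ε := by
  have hA := hv 0
  set A := fderiv ℂ f 0 with hAdef
  have hdet : LinearMap.det (A : En n →ₗ[ℂ] En n) ≠ 0 := by
    have : LinearMap.det (A : En n →ₗ[ℂ] En n) = 1 := hA
    rw [this]; exact one_ne_zero
  set B := (LinearMap.equivOfDetNeZero (A : En n →ₗ[ℂ] En n) hdet).toContinuousLinearEquiv with hB
  have hBA : ∀ z, B z = A z := fun z => rfl
  set Bi : En n →L[ℂ] En n := (B.symm : En n →L[ℂ] En n) with hBi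
  have hcomp : Bi.comp A = ContinuousLinearMap.id ℂ _ := by
    ext1 z
    simp [hBi, ← hBA]
  have hBid : Bi.det = 1 := by
    have h4 := congrArg ContinuousLinearMap.det hcomp
    unfold ContinuousLinearMap.det at h4 hA ⊢
    rw [ContinuousLinearMap.toLinearMap_comp, LinearMap.det_comp, hA, mul_one] at h4
    rw [h4]; simp
  have ps1 := ps_affine (-(Bi (f 0))) Bi hBid
  have ps2 := ps_affine (f 0) A hA
  obtain ⟨S, hS, hS'⟩ := density_normalized hn (f := fun z => -(Bi (f 0)) + Bi (f z)) (ps1.1.comp hf)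
    (ps1.2.1.comp hv ps1.1.1 hf.1) (by simp) (by
      rw [fderiv_const_add]
      have := (Bi.hasFDerivAt (x := f 0)).comp 0 (hf.1 0).hasFDerivAt
      have h' : HasFDerivAt (fun z => Bi (f z)) _ 0 := this
      rw [h'.fderiv]; exact hcomp) R (ε / (‖A‖ + 1)) (by positivity)
  refine ⟨_, ps2.comp hS, fun z hz => ?_⟩
  have e : f z - (f 0 + A (S z)) = A ((-(Bi (f 0)) + Bi (f z)) - S z) := by
    have : ∀ y, A (Bi y) = y := fun y => by rw [← hBA]; simp [hBi]
    rw [map_sub, map_add, map_neg, this, this]; abel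
  rw [e]
  refine (A.le_opNorm _).trans ?_
  have h3 := hS' z hz
  have : ‖A‖ * (ε / (‖A‖ + 1)) ≤ ε := by
    rw [mul_div_assoc', div_le_iff₀ (by positivity)]; nlinarith [norm_nonneg A]
  exact (mul_le_mul_of_nonneg_left h3 (norm_nonneg _)).trans this


lemma ev_homog {n k : ℕ} {p : MvPolynomial (Fin n) ℂ} (hp : p.IsHomogeneous k) (ζ : ℂ) (x : En n) :
    ev p (ζ • x) = ζ ^ k * ev p x := by
  unfold ev
  rw [MvPolynomial.eval_eq', MvPolynomial.eval_eq', Finset.mul_sum]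
  refine Finset.sum_congr rfl fun d hd => ?_
  have h1 : ∑ i, d i = k := by
    have := hp (MvPolynomial.mem_support_iff.1 hd)
    rw [← this, Finsupp.weight_apply, Finsupp.sum_fintype _ _ (by simp)]
    simp
  simp only [PiLp.smul_apply, smul_eq_mul, mul_pow, Finset.prod_mul_distrib]
  rw [Finset.prod_pow_eq_pow_sum, h1]
  ring

lemma ev_expand {n : ℕ} (P : MvPolynomial (Fin n) ℂ) (ζ : ℂ) (x : En n) :
    ev P (ζ • x) = ∑ k ∈ Finset.range (P.totalDegree + 1), ζ ^ k * ev (MvPolynomial.homogeneousComponent k P) x := by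
  conv_lhs => rw [← MvPolynomial.sum_homogeneousComponent P]
  have : ∀ (s : Finset ℕ) (q : ℕ → MvPolynomial (Fin n) ℂ) (z : En n), ev (∑ k ∈ s, q k) z = ∑ k ∈ s, ev (q k) z := by
    intro s q z; simp [ev]
  rw [this]
  exact Finset.sum_congr rfl fun k _ => ev_homog (MvPolynomial.homogeneousComponent_isHomogeneous k P) ζ x

lemma sum_bound {n : ℕ} (q : ℕ → MvPolynomial (Fin n) ℂ) (M : ℝ) (N d : ℕ) (hN : N ≤ d + 1) :
    ∃ B : ℝ, 0 < B ∧ ∀ (ζ : ℂ) (x : En n), ‖x‖ ≤ M → 1 ≤ ‖ζ‖ →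
      ‖∑ k ∈ Finset.range N, ζ ^ k * ev (q k) x‖ ≤ B * ‖ζ‖ ^ d := by
  choose B hB0 hB using fun k => exists_bound (ev_diff (q k)).continuous M
  refine ⟨∑ k ∈ Finset.range N, B k + 1, by
    have := Finset.sum_nonneg (s := Finset.range N) fun k _ => (hB0 k).le
    linarith, fun ζ x hx hζ => ?_⟩
  have h1 : ‖∑ k ∈ Finset.range N, ζ ^ k * ev (q k) x‖ ≤ ∑ k ∈ Finset.range N, B k * ‖ζ‖ ^ d := by
    refine norm_sum_le_of_le _ fun k hk => ?_
    rw [norm_mul, norm_pow, mul_comm]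
    have hk' : k ≤ d := by have := Finset.mem_range.1 hk; omega
    have := pow_le_pow_right₀ hζ hk'
    exact mul_le_mul (hB k x hx) this (by positivity) (hB0 k).le
  refine h1.trans ?_
  rw [← Finset.sum_mul, add_mul]
  have : 0 ≤ ‖ζ‖ ^ d := by positivity
  linarith

lemma grow_upper1 {n : ℕ} (P : MvPolynomial (Fin n) ℂ) (M : ℝ) (d : ℕ) (hd : P.totalDegree ≤ d) :
    ∃ B : ℝ, 0 < B ∧ ∀ (ζ : ℂ) (x : En n), ‖x‖ ≤ M → 1 ≤ ‖ζ‖ → ‖ev P (ζ • x)‖ ≤ B * ‖ζ‖ ^ d := by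
  obtain ⟨B, hB0, hB⟩ := sum_bound (fun k => MvPolynomial.homogeneousComponent k P) M (P.totalDegree + 1) d (by omega)
  exact ⟨B, hB0, fun ζ x hx hζ => by rw [ev_expand]; exact hB ζ x hx hζ⟩

lemma grow_upper {n : ℕ} {F : En n → En n} (hF : PolyMap F) (M : ℝ) :
    ∃ C : ℝ, 0 < C ∧ ∃ d : ℕ, ∀ (ζ : ℂ) (x : En n), ‖x‖ ≤ M → 1 ≤ ‖ζ‖ → ‖F (ζ • x)‖ ≤ C * ‖ζ‖ ^ d := by
  obtain ⟨P, hP⟩ := hF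
  set d := ∑ i, (P i).totalDegree with hd
  choose B hB0 hB using fun i => grow_upper1 (P i) M d
    (Finset.single_le_sum (f := fun i => (P i).totalDegree) (fun _ _ => Nat.zero_le _) (Finset.mem_univ i))
  refine ⟨∑ i, B i + 1, by
    have := Finset.sum_nonneg (s := Finset.univ) fun k _ => (hB0 k).le
    linarith, d, fun ζ x hx hζ => ?_⟩
  rw [vec_eq_sum (F (ζ • x))]
  have h1 : ‖∑ i, F (ζ • x) i • eb i‖ ≤ ∑ i, B i * ‖ζ‖ ^ d := by
    refine norm_sum_le_of_le _ fun i _ => ?_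
    rw [norm_smul, norm_eb, mul_one, hP]
    exact hB i ζ x hx hζ
  refine h1.trans ?_
  rw [← Finset.sum_mul, add_mul]
  have : 0 ≤ ‖ζ‖ ^ d := by positivity
  linarith

lemma grow_lower {n : ℕ} (P : MvPolynomial (Fin n) ℂ) (m : ℕ) (hm : P.totalDegree = m + 1) (e : En n)
    (he : ev (MvPolynomial.homogeneousComponent (m + 1) P) e ≠ 0) :
    ∃ c δ r0 : ℝ, 0 < c ∧ 0 < δ ∧ δ ≤ 1 ∧ 1 ≤ r0 ∧ ∀ (ζ : ℂ) (x : En n), ‖x - e‖ < δ → r0 ≤ ‖ζ‖ →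
      c * ‖ζ‖ ≤ ‖ev P (ζ • x)‖ := by
  set p := MvPolynomial.homogeneousComponent (m + 1) P with hp
  set c := ‖ev p e‖ / 4 with hc
  have hc0 : 0 < c := by have := norm_pos_iff.2 he; positivity
  obtain ⟨δ', hδ', hcont⟩ := Metric.continuous_iff.1 (ev_diff p).continuous e (2 * c) (by positivity)
  obtain ⟨B, hB0, hB⟩ := sum_bound (fun k => MvPolynomial.homogeneousComponent k P) (‖e‖ + 1) (m+1) m le_rfl
  refine ⟨c, min δ' 1, max 1 (B / c), hc0, by positivity, min_le_right _ _, le_max_left _ _, fun ζ x hx hζ => ?_⟩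
  rw [lt_min_iff] at hx
  have hζ1 : 1 ≤ ‖ζ‖ := (le_max_left _ _).trans hζ
  have hζ2 : B ≤ c * ‖ζ‖ := by
    rw [mul_comm, ← div_le_iff₀ hc0]; exact (le_max_right _ _).trans hζ
  have hxM : ‖x‖ ≤ ‖e‖ + 1 := by
    have : ‖x‖ ≤ ‖x - e‖ + ‖e‖ := by simpa using norm_add_le (x - e) e
    linarith
  have h1 := hcont x (by rw [dist_eq_norm]; exact hx.1)
  rw [dist_eq_norm] at h1
  have h2 : 2 * c ≤ ‖ev p x‖ := by
    have : ‖ev p e‖ ≤ ‖ev p x - ev p e‖ + ‖ev p x‖ := by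
      have := norm_sub_le (ev p x) (ev p x - ev p e)
      rw [sub_sub_cancel] at this; linarith
    have h4 : ‖ev p e‖ = 4 * c := by rw [hc]; ring
    linarith
  have h3 := hB ζ x hxM hζ1
  rw [ev_expand, hm, Finset.sum_range_succ]
  set A := ∑ k ∈ Finset.range (m + 1), ζ ^ k * ev (MvPolynomial.homogeneousComponent k P) x
  have h5 : ‖ζ ^ (m+1) * ev p x‖ ≤ ‖A + ζ ^ (m+1) * ev p x‖ + ‖A‖ := by
    have := norm_sub_le (A + ζ ^ (m+1) * ev p x) A
    rwa [add_sub_cancel_left] at this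
  have h6 : ‖ζ‖ ^ m * ‖ζ‖ * (2 * c) ≤ ‖ζ ^ (m+1) * ev p x‖ := by
    rw [norm_mul, norm_pow, ← pow_succ]; gcongr
  have h7 : 1 ≤ ‖ζ‖ ^ m := one_le_pow₀ hζ1
  have h8 : B * ‖ζ‖ ^ m ≤ c * ‖ζ‖ * ‖ζ‖ ^ m := by gcongr
  have h9 : c * ‖ζ‖ * 1 ≤ c * ‖ζ‖ * ‖ζ‖ ^ m := by gcongr
  linarith

lemma top_ne {n : ℕ} (P : MvPolynomial (Fin n) ℂ) (m : ℕ) (hm : P.totalDegree = m + 1) :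
    MvPolynomial.homogeneousComponent (m + 1) P ≠ 0 := by
  intro h
  have h1 := MvPolynomial.sum_homogeneousComponent P
  rw [hm, Finset.sum_range_succ, h, add_zero] at h1
  have h2 : P.totalDegree ≤ m := by
    rw [← h1]
    refine MvPolynomial.totalDegree_finsetSum_le fun k hk => ?_
    have := (MvPolynomial.homogeneousComponent_isHomogeneous k P).totalDegree_le
    have := Finset.mem_range.1 hk
    omega
  omega

lemma exists_dir {n : ℕ} (P : MvPolynomial (Fin n) ℂ) (m : ℕ) (hm : P.totalDegree = m + 1) (a : Fin n) :
    ∃ e : En n, e a = 1 ∧ ev (MvPolynomial.homogeneousComponent (m + 1) P) e ≠ 0 := by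
  have h1 : MvPolynomial.homogeneousComponent (m + 1) P * MvPolynomial.X a ≠ 0 :=
    mul_ne_zero (top_ne P m hm) (MvPolynomial.X_ne_zero a)
  obtain ⟨x, hx⟩ : ∃ x, MvPolynomial.eval x (MvPolynomial.homogeneousComponent (m + 1) P * MvPolynomial.X a) ≠ 0 := by
    by_contra hcon
    push Not at hcon
    exact h1 (MvPolynomial.funext fun x => by rw [hcon x, map_zero])
  rw [map_mul, MvPolynomial.eval_X] at hx
  have hxa : x a ≠ 0 := right_ne_zero_of_mul hx
  have hxp := left_ne_zero_of_mul hx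
  refine ⟨(x a)⁻¹ • WithLp.toLp 2 x, by simp [hxa], ?_⟩
  rw [ev_homog (MvPolynomial.homogeneousComponent_isHomogeneous _ P)]
  exact mul_ne_zero (pow_ne_zero _ (inv_ne_zero hxa)) hxp


lemma not_chaotic_of {n : ℕ} (G : En n → En n) (κ : En n → ℝ) (V : Set (En n)) (hV : IsOpen V) (hne : V.Nonempty)
    (h : ∀ z ∈ V, G z ∈ V ∧ κ z < κ (G z)) : ¬ Chaotic G := by
  rintro ⟨_, hd⟩
  obtain ⟨z, hzV, k, hk, hkz⟩ := hd.inter_open_nonempty V hV hne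
  have key : ∀ j : ℕ, G^[j + 1] z ∈ V ∧ κ z < κ (G^[j + 1] z) := by
    intro j
    induction j with
    | zero => simpa using h z hzV
    | succ j ih =>
      rw [Function.iterate_succ_apply']
      have := h _ ih.1
      exact ⟨this.1, ih.2.trans this.2⟩
  obtain ⟨j, rfl⟩ : ∃ j, k = j + 1 := ⟨k - 1, by omega⟩
  have := (key j).2
  rw [hkz] at this
  exact lt_irrefl _ this

lemma escape_num {n : ℕ} (μ lam : En n →L[ℂ] ℂ) (b : Fin n) (e u : En n) (hμe : μ e = 1)
    (hlb : lam (eb b) = 1) (hμn : ∀ z, ‖μ z‖ ≤ ‖z‖) (ε c C q K r δ : ℝ) (d N : ℕ) (hN : N = d + 2)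
    (hε : 0 < ε) (hc0 : 0 < c) (hq : q = ε * c ^ N) (hq0 : 0 < q) (hδ0 : 0 < δ) (hK1 : 1 < K)
    (hK2 : 2 * (1 + ‖e‖) / δ < K)
    (hρ2 : 2 ≤ r) (hρ3 : 4 * (K + 2) / ε ≤ r) (hρ4 : 1 / q ≤ r) (hρ5 : 2 * C * (1 + ‖lam‖) / q ≤ r)
    (hl : c * r ≤ ‖μ u‖) (hu : ‖u‖ ≤ C * r ^ d) (T s : ℂ) (z1 : En n) 
    (hT : T = (ε:ℂ) * (μ u) ^ N) (hz1def : z1 = u + T • eb b) (hs : s = (ε:ℂ) * (lam z1) ^ N) :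
    r < ‖μ (z1 + s • e)‖ ∧ ‖z1 + s • e - μ (z1 + s • e) • e‖ < δ * ‖μ (z1 + s • e)‖ := by
  have hnε : ‖(ε:ℂ)‖ = ε := by rw [Complex.norm_real, Real.norm_of_nonneg hε.le]
  have hTlow : q * r ^ N ≤ ‖T‖ := by
    rw [hT, norm_mul, norm_pow, hnε, hq, mul_assoc, ← mul_pow]
    have : c * r ≤ ‖μ u‖ := hl
    gcongr
  have hqr1 : 1 ≤ q * r := by
    have := (div_le_iff₀ hq0).1 hρ4; linarith
  have hqr2 : 2 * C * (1 + ‖lam‖) ≤ q * r := by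
    have := (div_le_iff₀ hq0).1 hρ5; linarith
  have hrd : 1 ≤ r ^ d := one_le_pow₀ (by linarith)
  have hpow : q * r ^ N = q * r * r ^ d * r := by rw [hN]; ring
  have hT1 : r ≤ ‖T‖ := by
    refine le_trans ?_ hTlow
    rw [hpow]
    have : 1 ≤ q * r * r ^ d := one_le_mul_of_one_le_of_one_le hqr1 hrd
    nlinarith
  have hT2 : 2 * (1 + ‖lam‖) * ‖u‖ ≤ ‖T‖ := by
    refine le_trans ?_ hTlow
    rw [hpow]
    have h1 : 2 * (1 + ‖lam‖) * ‖u‖ ≤ 2 * (1 + ‖lam‖) * (C * r ^ d) := by gcongr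
    have h2 : 2 * (1 + ‖lam‖) * (C * r ^ d) ≤ q * r * r ^ d := by
      have := mul_le_mul_of_nonneg_right hqr2 (by positivity : (0:ℝ) ≤ r ^ d)
      linarith
    have h3 : 0 ≤ q * r * r ^ d := by positivity
    nlinarith
  have hlamn := norm_nonneg lam
  have hun := norm_nonneg u
  have hz1n : ‖z1‖ ≤ 2 * ‖T‖ := by
    rw [hz1def]
    refine (norm_add_le _ _).trans ?_
    rw [norm_smul, norm_eb, mul_one]
    nlinarith [mul_nonneg hlamn hun]
  have hlz1 : ‖T‖ / 2 ≤ ‖lam z1‖ := by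
    have h1 : lam z1 = lam u + T := by rw [hz1def, map_add, map_smul, hlb]; simp
    have h2 : ‖T‖ ≤ ‖lam u + T‖ + ‖lam u‖ := by
      have := norm_sub_le (lam u + T) (lam u); rwa [add_sub_cancel_left] at this
    have h3 := lam.le_opNorm u
    rw [h1]
    nlinarith
  have hslow : ε * (‖T‖ / 2) ^ 2 ≤ ‖s‖ := by
    rw [hs, norm_mul, norm_pow, hnε]
    have h1 : (‖T‖ / 2) ^ 2 ≤ (‖T‖ / 2) ^ N := pow_le_pow_right₀ (by linarith) (by omega)
    have h2 : (‖T‖ / 2) ^ N ≤ ‖lam z1‖ ^ N := by gcongr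
    exact mul_le_mul_of_nonneg_left (h1.trans h2) hε.le
  have hΛT : 4 * (K + 2) ≤ ε * ‖T‖ := by
    have := hρ3.trans hT1
    rw [div_le_iff₀ hε] at this; linarith
  have hTpos : 0 < ‖T‖ := by linarith
  have hsK : (K + 2) * ‖T‖ ≤ ‖s‖ := by
    refine le_trans ?_ hslow
    nlinarith
  have hμ2 : μ (z1 + s • e) = μ z1 + s := by rw [map_add, map_smul, hμe]; simp
  have hμz1 : ‖μ z1‖ ≤ 2 * ‖T‖ := (hμn z1).trans hz1n
  have hfin : K * ‖T‖ ≤ ‖μ z1 + s‖ := by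
    have : ‖s‖ ≤ ‖μ z1 + s‖ + ‖μ z1‖ := by
      have := norm_sub_le (μ z1 + s) (μ z1); rwa [add_sub_cancel_left] at this
    linarith
  rw [hμ2]
  constructor
  · nlinarith
  · have h1 : z1 + s • e - (μ z1 + s) • e = z1 - μ z1 • e := by rw [add_smul]; abel
    rw [h1]
    have h2 : ‖z1 - μ z1 • e‖ ≤ 2 * ‖T‖ + 2 * ‖T‖ * ‖e‖ := by
      refine (norm_sub_le _ _).trans ?_
      rw [norm_smul]
      have := mul_le_mul_of_nonneg_right hμz1 (norm_nonneg e)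
      linarith
    rw [div_lt_iff₀ hδ0] at hK2
    have h3 : 2 * (1 + ‖e‖) * ‖T‖ < K * δ * ‖T‖ := mul_lt_mul_of_pos_right hK2 hTpos
    have h4 : δ * (K * ‖T‖) ≤ δ * ‖μ z1 + s‖ := mul_le_mul_of_nonneg_left hfin hδ0.le
    nlinarith

set_option maxHeartbeats 1000000 in
lemma escape {n : ℕ} (hn : 2 ≤ n) {F : En n → En n} (hF : PS F) (R ε0 : ℝ) (hε0 : 0 < ε0) :
    ∃ G, PS G ∧ (∀ z, ‖z‖ ≤ R → ‖F z - G z‖ ≤ ε0) ∧ ¬ Chaotic G := by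
  set a : Fin n := ⟨0, by omega⟩ with ha
  set b : Fin n := ⟨1, by omega⟩ with hb
  have hab : a ≠ b := by simp [ha, hb]
  clear_value a b
  obtain ⟨P, hP⟩ := hF.2.2
  obtain ⟨m, hm⟩ : ∃ m, (P a).totalDegree = m + 1 := by
    refine Nat.exists_eq_succ_of_ne_zero fun h0 => ?_
    rw [MvPolynomial.totalDegree_eq_zero_iff_eq_C] at h0
    obtain ⟨-, g, -, -, hg⟩ := hF.1
    have h1 := hP (g (0 : En n)) a
    have h2 := hP (g (eb a)) a
    rw [hg, h0] at h1 h2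
    simp only [ev, MvPolynomial.eval_C] at h1 h2
    rw [← h1] at h2
    simp at h2
  obtain ⟨e, hea, hep⟩ := exists_dir (P a) m hm a
  obtain ⟨c, δ, r0, hc0, hδ0, hδ1, hr0, hlow⟩ := grow_lower (P a) m hm e hep
  obtain ⟨C, hC0, d, hup⟩ := grow_upper hF.2.2 (‖e‖ + 1)
  set N := d + 2 with hN
  set μ : En n →L[ℂ] ℂ := EuclideanSpace.proj a with hμ
  set lam : En n →L[ℂ] ℂ := EuclideanSpace.proj b - e b • (EuclideanSpace.proj a : En n →L[ℂ] ℂ) with hlam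
  have hμa : ∀ z, μ z = z a := fun z => rfl
  have hμb : μ (eb b) = 0 := by simp [hμ, hab]
  have hle : lam e = 0 := by simp [hlam, hea]
  have hlb : lam (eb b) = 1 := by simp [hlam, hab]
  obtain ⟨M, hM0, hM⟩ := exists_bound hF.1.1.continuous R
  obtain ⟨ε, hε, hε1, hε2⟩ : ∃ ε : ℝ, 0 < ε ∧ ε * M ^ N ≤ min 1 (ε0 / 2) ∧
      ε * ((‖lam‖ * (M + 1)) ^ N * ‖e‖) ≤ ε0 / 2 := by
    refine ⟨min (min 1 (ε0 / 2) / (M ^ N + 1)) (ε0 / 2 / ((‖lam‖ * (M + 1)) ^ N * ‖e‖ + 1)), by positivity, ?_, ?_⟩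
    · refine (mul_le_mul_of_nonneg_right (min_le_left _ _) (by positivity)).trans ?_
      rw [div_mul_eq_mul_div, div_le_iff₀ (by positivity)]
      have : 0 < min 1 (ε0 / 2) := by positivity
      nlinarith
    · refine (mul_le_mul_of_nonneg_right (min_le_right _ _) (by positivity)).trans ?_
      rw [div_mul_eq_mul_div, div_le_iff₀ (by positivity)]
      nlinarith
  have hnε : ‖(ε:ℂ)‖ = ε := by rw [Complex.norm_real, Real.norm_of_nonneg hε.le]
  have ps1 := ps_shear μ (eb b) hμb ε N
  have ps2 := ps_shear lam e hle ε N
  refine ⟨_, ps2.comp (ps1.comp hF), ?_, ?_⟩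
  · intro z hz
    have hu := hM z hz
    set u := F z
    set z1 := u + ((ε:ℂ) * (μ u) ^ N) • eb b with hz1
    have d1 : ‖u - z1‖ ≤ min 1 (ε0 / 2) := by
      have : u - z1 = -(((ε:ℂ) * (μ u) ^ N) • eb b) := by rw [hz1]; abel
      rw [this, norm_neg, norm_smul, norm_eb, mul_one, norm_mul, norm_pow, hnε]
      refine le_trans ?_ hε1
      gcongr
      exact (norm_coord_le u a).trans hu
    have b1 : ‖z1‖ ≤ M + 1 := by
      have : ‖z1‖ ≤ ‖u‖ + ‖u - z1‖ := by
        have := norm_sub_le u (u - z1); rwa [sub_sub_cancel] at this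
      linarith [min_le_left 1 (ε0 / 2)]
    have d2 : ‖z1 - (z1 + ((ε:ℂ) * (lam z1) ^ N) • e)‖ ≤ ε0 / 2 := by
      have : z1 - (z1 + ((ε:ℂ) * (lam z1) ^ N) • e) = -(((ε:ℂ) * (lam z1) ^ N) • e) := by abel
      rw [this, norm_neg, norm_smul, norm_mul, norm_pow, hnε, mul_assoc]
      refine le_trans ?_ hε2
      gcongr
      exact (lam.le_opNorm z1).trans (by gcongr)
    refine (norm_sub_le_norm_sub_add_norm_sub u z1 _).trans ?_
    linarith [min_le_right 1 (ε0 / 2)]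
  · set K := 1 + 2 * (1 + ‖e‖) / δ with hK
    have hK1 : 1 < K := by rw [hK]; have : 0 < 2 * (1 + ‖e‖) / δ := by positivity
                           linarith
    have hK2 : 2 * (1 + ‖e‖) / δ < K := by rw [hK]; linarith
    set Λ := 4 * (K + 2) / ε with hΛ
    set q := ε * c ^ N with hq
    have hq0 : 0 < q := by positivity
    set ρ := max (max r0 2) (max Λ (max (1 / q) (2 * C * (1 + ‖lam‖) / q))) with hρ
    have hρ1 : r0 ≤ ρ := (le_max_left _ _).trans (le_max_left _ _)
    have hρ2 : 2 ≤ ρ := (le_max_right _ _).trans (le_max_left _ _)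
    have hρ3 : Λ ≤ ρ := (le_max_left _ _).trans (le_max_right _ _)
    have hρ4 : 1 / q ≤ ρ := (le_max_left _ _).trans ((le_max_right _ _).trans (le_max_right _ _))
    have hρ5 : 2 * C * (1 + ‖lam‖) / q ≤ ρ :=
      (le_max_right _ _).trans ((le_max_right _ _).trans (le_max_right _ _))
    clear_value ρ
    refine not_chaotic_of _ (fun z => ‖μ z‖) {z | ρ < ‖μ z‖ ∧ ‖z - μ z • e‖ < δ * ‖μ z‖} ?_ ?_ ?_
    · refine IsOpen.and (isOpen_lt continuous_const ?_) (isOpen_lt ?_ ?_) <;> fun_prop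
    · refine ⟨((ρ + 1 : ℝ) : ℂ) • e, ?_⟩
      have h1 : μ (((ρ + 1 : ℝ) : ℂ) • e) = ((ρ + 1 : ℝ) : ℂ) := by simp [hμa, hea]
      have h2 : ‖((ρ + 1 : ℝ) : ℂ)‖ = ρ + 1 := by
        rw [Complex.norm_real, Real.norm_of_nonneg (by linarith)]
      simp only [mem_ofPred_eq, h1, h2, sub_self, norm_zero]
      exact ⟨by linarith, by positivity⟩
    · rintro z ⟨hz1, hz2⟩
      obtain ⟨ζ, hζ⟩ : ∃ ζ, ζ = μ z := ⟨_, rfl⟩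
      obtain ⟨r, hr⟩ : ∃ r, r = ‖ζ‖ := ⟨_, rfl⟩
      rw [← hζ, ← hr] at hz1 hz2
      have hrpos : 0 < r := by linarith
      have hζ0 : ζ ≠ 0 := norm_pos_iff.1 (hr ▸ hrpos)
      obtain ⟨x, hx⟩ : ∃ x, x = ζ⁻¹ • z := ⟨_, rfl⟩
      have hzx : z = ζ • x := by rw [hx, smul_smul, mul_inv_cancel₀ hζ0, one_smul]
      have hxe : ‖x - e‖ < δ := by
        have : x - e = ζ⁻¹ • (z - ζ • e) := by
          rw [smul_sub, smul_smul, inv_mul_cancel₀ hζ0, one_smul, hx]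
        rw [this, norm_smul, norm_inv, ← hr, inv_mul_lt_iff₀ hrpos, mul_comm]; exact hz2
      have hxM : ‖x‖ ≤ ‖e‖ + 1 := by
        have : ‖x‖ ≤ ‖x - e‖ + ‖e‖ := by simpa using norm_add_le (x - e) e
        linarith
      have hl := hlow ζ x hxe (by rw [← hr]; linarith)
      have hu := hup ζ x hxM (by rw [← hr]; linarith)
      rw [← hzx, ← hP] at hl
      rw [← hzx] at hu
      rw [← hr] at hl hu
      have hh := escape_num μ lam b e (F z) (by rw [hμa, hea]) hlb (fun z => norm_coord_le z a) ε c C q K r δ d N hN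
        hε hc0 hq hq0 hδ0 hK1 hK2 (by linarith) (by rw [← hΛ]; linarith) (by linarith) (by linarith) hl hu _ _ _ rfl rfl rfl
      refine ⟨⟨hz1.trans hh.1, hh.2⟩, ?_⟩
      refine lt_of_eq_of_lt ?_ hh.1
      rw [hr, hζ]


theorem stmt_3 (n : ℕ) (hn : 2 ≤ n) (U : Set ↥(AutOmega n)) (hU : IsOpen U)
    (hne : U.Nonempty) : ∃ f ∈ U, ¬ Chaotic ⇑f.1 := by
  obtain ⟨f, hf⟩ := hne
  have key : ∀ k : ℕ, ∃ g : ↥(AutOmega n), ¬ Chaotic ⇑g.1 ∧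
      ∀ z, ‖z‖ ≤ (k:ℝ) → ‖f.1 z - g.1 z‖ ≤ 1 / ((k:ℝ) + 1) := by
    intro k
    have hk : (0:ℝ) < 1 / ((k:ℝ) + 1) / 2 := by positivity
    obtain ⟨S, hS, hfS⟩ := density hn f.2.1 f.2.2 k _ hk
    obtain ⟨G, hG, hSG, hch⟩ := escape hn hS k _ hk
    refine ⟨⟨⟨G, hG.1.1.continuous⟩, hG.1, hG.2.1⟩, hch, fun z hz => ?_⟩
    refine (norm_sub_le_norm_sub_add_norm_sub (f.1 z) (S z) _).trans ?_
    have h1 := hfS z hz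
    have h2 := hSG z hz
    refine (add_le_add h1 h2).trans ?_
    linarith
  choose g hg1 hg2 using key
  have ht : Tendsto g atTop (𝓝 f) := by
    rw [tendsto_subtype_rng, ContinuousMap.tendsto_iff_forall_isCompact_tendstoUniformlyOn]
    intro K hK
    rw [Metric.tendstoUniformlyOn_iff]
    intro ε hε
    obtain ⟨R, hR⟩ := hK.isBounded.exists_norm_le
    obtain ⟨k1, hk1⟩ := exists_nat_ge R
    obtain ⟨k2, hk2⟩ := exists_nat_one_div_lt hε
    filter_upwards [eventually_ge_atTop k1, eventually_ge_atTop k2] with k h1 h2 z hz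
    rw [dist_eq_norm]
    have h1' : (k1:ℝ) ≤ k := by exact_mod_cast h1
    refine (hg2 k z ((hR z hz).trans (hk1.trans h1'))).trans_lt ?_
    exact (Nat.one_div_le_one_div h2).trans_lt hk2
  obtain ⟨k, hk⟩ := (ht.eventually (hU.mem_nhds hf)).exists
  exact ⟨g k, hk, hg1 k⟩
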